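/- arXiv:2012.08685 — 5 statements merged into one kernel-verified Lean document; each statement's English description precedes it below -/
import Mathlib

section
/- Let X be a complete, locally compact, geodesic metric space of finite Hausdorff dimension with diameter ≤ π whose metric has curvature ≥ 1 in the comparison sense, and suppose z₁, z₂ ∈ X satisfy d(z₁,z₂) = π. Let F be a quasi-convex subset of X containing z₁ and at least one other point. Then z₂ ∈ F, and for every r ∈ F with 0 < d(z₁,r) < π, every x ∈ X satisfying d(z₁,x) + d(x,z₂) = π and d(x,r) = |d(z₁,x) − d(z₁,r)| belongs to F (that is, the whole minimal geodesic from z₁ to z₂ passing through r is contained in F). -/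
open Metric

/-- Spherical comparison angle at `p` between `x` and `y`. -/
noncomputable def compAngle₁ {X : Type*} [MetricSpace X] (x p y : X) : ℝ :=
  Real.arccos ((Real.cos (dist x y) - Real.cos (dist p x) * Real.cos (dist p y)) /
    (Real.sin (dist p x) * Real.sin (dist p y)))

/-- `X` has curvature `≥ 1` in the comparison sense. -/
def CurvCompGE1 (X : Type*) [MetricSpace X] : Prop :=
  (∀ x y : X, dist x y ≤ Real.pi) ∧
    ∀ p a b c : X, 0 < dist p a → dist p a < Real.pi → 0 < dist p b → dist p b < Real.pi →
      0 < dist p c → dist p c < Real.pi →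
      compAngle₁ a p b + compAngle₁ b p c + compAngle₁ c p a ≤ 2 * Real.pi

/-- `X` is a geodesic space: every two points have a midpoint. -/
def GeodesicSpace (X : Type*) [MetricSpace X] : Prop :=
  ∀ x y : X, ∃ m : X, dist x m = dist x y / 2 ∧ dist m y = dist x y / 2

/-- `F` is a quasi-convex subset of `X` (comparison-angle formulation, curvature `≥ 1`). -/
def IsQuasiConvex₁ {X : Type*} [MetricSpace X] (F : Set X) : Prop :=
  IsClosed F ∧
    ∀ q p : X, q ∉ F → p ∈ F → dist q p = infDist q F →
      ∀ r ∈ F, Real.cos (dist q p) * Real.cos (dist p r) ≤ Real.cos (dist q r)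

lemma aux_exists_geodesic {X : Type*} [MetricSpace X] [CompleteSpace X]
    (hgeo : GeodesicSpace X) (x y : X) :
    ∃ γ : ℝ → X, γ 0 = x ∧ γ (dist x y) = y ∧
      ∀ s ∈ Set.Icc 0 (dist x y), ∀ t ∈ Set.Icc 0 (dist x y), dist (γ s) (γ t) = |s - t| := by
  classical
  set P : Set (Set X) := {S | x ∈ S ∧ y ∈ S ∧ (∀ u ∈ S, dist x u ≤ dist x y) ∧
    ∀ u ∈ S, ∀ v ∈ S, dist u v = |dist x u - dist x v|} with hP
  have hbase : ({x, y} : Set X) ∈ P := by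
    refine ⟨by simp, by simp, ?_, ?_⟩
    · intro u hu
      rcases hu with rfl | rfl <;> simp
    · intro u hu v hv
      rcases hu with rfl | rfl <;> rcases hv with rfl | rfl <;> simp [dist_comm]
  obtain ⟨S, -, hS⟩ := zorn_subset_nonempty P (by
    intro c hc hchain hne
    refine ⟨⋃₀ c, ?_, fun s hs => Set.subset_sUnion_of_mem hs⟩
    obtain ⟨s0, hs0⟩ := hne
    refine ⟨⟨s0, hs0, (hc hs0).1⟩, ⟨s0, hs0, (hc hs0).2.1⟩, ?_, ?_⟩
    · rintro u ⟨s, hs, hu⟩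
      exact (hc hs).2.2.1 u hu
    · rintro u ⟨s, hs, hu⟩ v ⟨t, ht, hv⟩
      rcases hchain.total hs ht with h | h
      · exact (hc ht).2.2.2 u (h hu) v hv
      · exact (hc hs).2.2.2 u hu v (h hv)) _ hbase
  obtain ⟨⟨hxS, hyS, hle, hiso⟩, hmax⟩ := hS
  have key : ∀ m : X, dist x m ≤ dist x y → (∀ w ∈ S, dist m w = |dist x m - dist x w|) →
      m ∈ S := by
    intro m hm hw
    have : insert m S ∈ P := by
      refine ⟨Set.mem_insert_of_mem _ hxS, Set.mem_insert_of_mem _ hyS, ?_, ?_⟩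
      · rintro u (rfl | hu)
        · exact hm
        · exact hle u hu
      · rintro u (rfl | hu) v (rfl | hv)
        · simp
        · exact hw v hv
        · rw [dist_comm, hw u hu, abs_sub_comm]
        · exact hiso u hu v hv
    exact hmax this (Set.subset_insert _ _) (Set.mem_insert _ _)
  have hclosed : IsClosed S := by
    rw [← closure_subset_iff_isClosed]
    intro m hm
    refine key m ?_ ?_
    · have : closure S ⊆ {u | dist x u ≤ dist x y} :=
        closure_minimal hle (isClosed_le (by fun_prop) (by fun_prop))
      exact this hm
    · intro w hw
      have : closure S ⊆ {u | dist u w = |dist x u - dist x w|} :=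
        closure_minimal (fun u hu => hiso u hu w hw) (isClosed_eq (by fun_prop) (by fun_prop))
      exact this hm
  have hTclosed : IsClosed ((fun u => dist x u) '' S) := by
    have h1 : IsComplete S := hclosed.isComplete
    have hI : Isometry (fun u : S => dist x (u : X)) := by
      refine Isometry.of_dist_eq ?_
      intro u v
      rw [Real.dist_eq, ← hiso u u.2 v v.2]; rfl
    have h2 : (fun u => dist x u) '' S = Set.range (fun u : S => dist x (u : X)) := by
      ext t; simp
    have : CompleteSpace S := h1.completeSpace_coe
    rw [h2]
    exact hI.isClosedEmbedding.isClosed_range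
  have hsurj : ∀ t ∈ Set.Icc 0 (dist x y), ∃ u ∈ S, dist x u = t := by
    intro t ht
    set T := (fun u => dist x u) '' S with hT
    by_contra hno
    have htT : t ∉ T := fun ⟨u, hu, h⟩ => hno ⟨u, hu, h⟩
    obtain ⟨a, ⟨haT, ha⟩, hamax⟩ := (isCompact_Icc.inter_left hTclosed :
      IsCompact (T ∩ Set.Icc 0 t)).exists_isGreatest ⟨0, ⟨x, hxS, by simp⟩, le_refl _, ht.1⟩
    obtain ⟨b, ⟨hbT, hb⟩, hbmin⟩ := (isCompact_Icc.inter_left hTclosed :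
      IsCompact (T ∩ Set.Icc t (dist x y))).exists_isLeast ⟨dist x y, ⟨y, hyS, rfl⟩, ht.2, le_refl _⟩
    obtain ⟨u, huS, hu⟩ := haT
    obtain ⟨v, hvS, hv⟩ := hbT
    simp only at hu hv
    have hat : a < t := lt_of_le_of_ne ha.2 (fun h => htT (h ▸ ⟨u, huS, hu⟩))
    have hbt : t < b := lt_of_le_of_ne hb.1 (fun h => htT (h ▸ ⟨v, hvS, hv⟩))
    obtain ⟨m, hm1, hm2⟩ := hgeo u v
    have huv : dist u v = b - a := by
      rw [hiso u huS v hvS, hu, hv, abs_sub_comm, abs_of_pos (by linarith)]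
    rw [huv] at hm1 hm2
    have gap : ∀ w ∈ S, dist x w ≤ a ∨ b ≤ dist x w := by
      intro w hw
      rcases le_total (dist x w) t with h | h
      · exact Or.inl (hamax ⟨⟨w, hw, rfl⟩, dist_nonneg, h⟩)
      · exact Or.inr (hbmin ⟨⟨w, hw, rfl⟩, h, hle w hw⟩)
    have dlow : ∀ w ∈ S, dist x w ≤ a → dist m w = (a + b) / 2 - dist x w := by
      intro w hw hwa
      have e1 : dist w u = a - dist x w := by
        rw [hiso w hw u huS, hu, abs_sub_comm, abs_of_nonneg (by linarith)]
      have e2 : dist w v = b - dist x w := by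
        rw [hiso w hw v hvS, hv, abs_sub_comm, abs_of_nonneg (by linarith)]
      have t1 := dist_triangle w u m
      have t2 := dist_triangle w m v
      rw [dist_comm m w]
      linarith
    have dhigh : ∀ w ∈ S, b ≤ dist x w → dist m w = dist x w - (a + b) / 2 := by
      intro w hw hwb
      have e1 : dist u w = dist x w - a := by
        rw [hiso u huS w hw, hu, abs_sub_comm, abs_of_nonneg (by linarith)]
      have e2 : dist v w = dist x w - b := by
        rw [hiso v hvS w hw, hv, abs_sub_comm, abs_of_nonneg (by linarith)]
      have t1 := dist_triangle u m w
      have t2 := dist_triangle m v w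
      linarith
    have hxm : dist x m = (a + b) / 2 := by
      have := dlow x hxS (by simpa using ha.1)
      rw [dist_comm, this]; simp
    have hmS : m ∈ S := by
      refine key m (by rw [hxm]; linarith [hb.2]) ?_
      intro w hw
      rw [hxm]
      rcases gap w hw with h | h
      · rw [dlow w hw h, abs_of_nonneg (by linarith)]
      · rw [dhigh w hw h, abs_sub_comm, abs_of_nonneg (by linarith)]
    rcases gap m hmS with h | h <;> linarith
  have : Nonempty X := ⟨x⟩
  choose! γ hγS hγ using hsurj
  have h0 : (0 : ℝ) ∈ Set.Icc 0 (dist x y) := ⟨le_refl _, dist_nonneg⟩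
  have h1 : dist x y ∈ Set.Icc 0 (dist x y) := ⟨dist_nonneg, le_refl _⟩
  refine ⟨γ, ?_, ?_, ?_⟩
  · exact (dist_eq_zero.1 (hγ 0 h0)).symm
  · have := hiso _ (hγS _ h1) y hyS
    rw [hγ _ h1] at this
    simpa using this
  · intro s hs t ht
    rw [hiso _ (hγS s hs) _ (hγS t ht), hγ s hs, hγ t ht]

lemma aux_arccos {A B : ℝ} (hA : -1 ≤ A) (hB : -1 ≤ B)
    (h : Real.arccos A + Real.arccos B ≤ Real.pi) : 0 ≤ A + B := by
  by_contra hlt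
  push Not at hlt
  have h1 : Real.arccos (-B) < Real.arccos A :=
    Real.strictAntiOn_arccos ⟨hA, by linarith⟩ ⟨by linarith, by linarith⟩ (by linarith)
  rw [Real.arccos_neg] at h1
  linarith

/-- The comparison angle at an interior point of a geodesic is `π`. -/
lemma aux_angle_pi {X : Type*} [MetricSpace X] (x p y : X) (hx : 0 < dist p x)
    (hy : 0 < dist p y) (h : dist x y = dist p x + dist p y) (hxy : dist p x < Real.pi)
    (hyy : dist p y < Real.pi) :
    compAngle₁ x p y = Real.pi := by
  have s1 := Real.sin_pos_of_pos_of_lt_pi hx hxy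
  have s2 := Real.sin_pos_of_pos_of_lt_pi hy hyy
  unfold compAngle₁
  rw [h, Real.cos_add]
  have : (Real.cos (dist p x) * Real.cos (dist p y) - Real.sin (dist p x) * Real.sin (dist p y) -
    Real.cos (dist p x) * Real.cos (dist p y)) / (Real.sin (dist p x) * Real.sin (dist p y)) = -1 := by
    field_simp; ring
  rw [this, Real.arccos_neg_one]

lemma aux_sum_pi {X : Type*} [MetricSpace X] (hcurv : CurvCompGE1 X) (p x y w : X)
    (hx : 0 < dist p x) (hxy : dist p x < Real.pi)
    (hy : 0 < dist p y) (hyy : dist p y < Real.pi)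
    (hw : 0 < dist p w) (hww : dist p w < Real.pi)
    (h : dist x y = dist p x + dist p y) :
    Real.arccos ((Real.cos (dist x w) - Real.cos (dist p x) * Real.cos (dist p w)) /
      (Real.sin (dist p x) * Real.sin (dist p w))) +
    Real.arccos ((Real.cos (dist y w) - Real.cos (dist p y) * Real.cos (dist p w)) /
      (Real.sin (dist p y) * Real.sin (dist p w))) ≤ Real.pi := by
  have h1 := hcurv.2 p x y w hx hxy hy hyy hw hww
  rw [aux_angle_pi x p y hx hy h hxy hyy] at h1
  have h2 : compAngle₁ w p x = compAngle₁ x p w := by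
    unfold compAngle₁
    rw [dist_comm w x, mul_comm (Real.cos (dist p w)), mul_comm (Real.sin (dist p w))]
  rw [h2] at h1
  unfold compAngle₁ at h1
  linarith

lemma aux_pole_core {X : Type*} [MetricSpace X] (hcurv : CurvCompGE1 X) (z₁ z₂ w m : X)
    (ε : ℝ) (h1 : dist m z₁ = ε) (h2 : dist m z₂ = Real.pi - ε) (hz : dist z₁ z₂ = Real.pi)
    (hε : 0 < ε) (hε' : ε < Real.pi) (ha : Real.pi - ε < dist z₁ w) (hb : ε < dist z₂ w)
    (hd : dist m w < Real.pi) : dist z₁ w + dist z₂ w ≤ Real.pi := by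
  rcases dist_nonneg.eq_or_lt (a := 0) (b := dist m w) with h0 | h0
  · have := dist_eq_zero.1 h0.symm
    subst this
    rw [dist_comm z₁, dist_comm z₂, h1, h2]; linarith
  have key := aux_sum_pi hcurv m z₁ z₂ w (by linarith) (by linarith) (by linarith) (by linarith)
    h0 hd (by linarith)
  have ta := dist_triangle z₁ m w
  have tb := dist_triangle z₂ m w
  rw [dist_comm z₁ m] at ta
  rw [dist_comm z₂ m] at tb
  have apos := hcurv.1 z₁ w
  have bpos := hcurv.1 z₂ w
  rw [h1, h2] at key
  rw [h1] at ta
  rw [h2] at tb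
  generalize dist z₁ w = a at *
  generalize dist z₂ w = b at *
  generalize dist m w = d at *
  have se := Real.sin_pos_of_pos_of_lt_pi hε hε'
  have sd := Real.sin_pos_of_pos_of_lt_pi h0 hd
  rw [Real.cos_pi_sub, Real.sin_pi_sub] at key
  have hsp : 0 < Real.sin ε * Real.sin d := mul_pos se sd
  set A := (Real.cos a - Real.cos ε * Real.cos d) / (Real.sin ε * Real.sin d) with hA
  set B := (Real.cos b - -Real.cos ε * Real.cos d) / (Real.sin ε * Real.sin d) with hB
  by_cases hA1 : -1 ≤ A
  · by_cases hB1 : -1 ≤ B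
    · have h := aux_arccos hA1 hB1 key
      rw [hA, hB, ← add_div] at h
      have h' : 0 ≤ Real.cos a + Real.cos b := by
        by_contra hn
        push Not at hn
        have := div_neg_of_neg_of_pos (a := Real.cos a - Real.cos ε * Real.cos d +
          (Real.cos b - -Real.cos ε * Real.cos d)) (by linarith) hsp
        linarith
      by_contra hn
      push Not at hn
      have : Real.cos a < Real.cos (Real.pi - b) :=
        Real.cos_lt_cos_of_nonneg_of_le_pi (by linarith) apos (by linarith)
      rw [Real.cos_pi_sub] at this
      linarith
    · push Not at hB1
      exfalso
      rw [Real.arccos_of_le_neg_one hB1.le] at key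
      have hA2 : 1 ≤ A := Real.arccos_eq_zero.1 (le_antisymm (by linarith) (Real.arccos_nonneg _))
      rw [hB, div_lt_iff₀ hsp] at hB1
      rw [hA, le_div_iff₀ hsp] at hA2
      have c1 : Real.cos b < Real.cos (Real.pi - ε + d) := by
        rw [Real.cos_add, Real.cos_pi_sub, Real.sin_pi_sub]; linarith
      have c2 : Real.cos (d - ε) ≤ Real.cos a := by
        rw [Real.cos_sub]; linarith
      have hde : ε < d := by
        by_contra hn
        push Not at hn
        have := Real.cos_le_cos_of_nonneg_of_le_pi (by linarith) (by linarith) tb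
        linarith
      have : a ≤ d - ε := by
        by_contra hn
        push Not at hn
        have := Real.cos_lt_cos_of_nonneg_of_le_pi (by linarith) apos hn
        linarith
      linarith
  · push Not at hA1
    exfalso
    rw [Real.arccos_of_le_neg_one hA1.le] at key
    have hB2 : 1 ≤ B := Real.arccos_eq_zero.1 (le_antisymm (by linarith) (Real.arccos_nonneg _))
    rw [hA, div_lt_iff₀ hsp] at hA1
    rw [hB, le_div_iff₀ hsp] at hB2
    have c1 : Real.cos a < Real.cos (ε + d) := by
      rw [Real.cos_add]; linarith
    have c2 : Real.cos (ε + d - Real.pi) ≤ Real.cos b := by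
      rw [Real.cos_sub_pi, Real.cos_add]; linarith
    have hde : Real.pi < ε + d := by
      by_contra hn
      push Not at hn
      have := Real.cos_le_cos_of_nonneg_of_le_pi (by linarith) (by linarith) ta
      linarith
    have : b ≤ ε + d - Real.pi := by
      by_contra hn
      push Not at hn
      have := Real.cos_lt_cos_of_nonneg_of_le_pi (by linarith) bpos hn
      linarith
    linarith

lemma aux_pole {X : Type*} [MetricSpace X] [CompleteSpace X] (hgeo : GeodesicSpace X)
    (hcurv : CurvCompGE1 X) (z₁ z₂ : X) (hz : dist z₁ z₂ = Real.pi) (w : X) :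
    dist z₁ w + dist z₂ w = Real.pi := by
  refine le_antisymm ?_ (by have := dist_triangle z₁ w z₂; rw [dist_comm w] at this; linarith)
  by_contra hn
  push Not at hn
  have hpi := Real.pi_pos
  have a1 := hcurv.1 z₁ w
  have b1 := hcurv.1 z₂ w
  obtain ⟨γ, g0, g1, hγ⟩ := aux_exists_geodesic hgeo z₁ z₂
  rw [hz] at g1 hγ
  set e := dist z₁ w + dist z₂ w - Real.pi with he
  set ε := Real.pi - dist z₁ w + e / 2 with hε
  have hεpos : 0 < ε := by linarith
  have hεpi : ε < Real.pi := by linarith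
  have m1 : dist (γ ε) z₁ = ε := by
    rw [← g0, hγ ε ⟨hεpos.le, hεpi.le⟩ 0 ⟨le_refl _, hpi.le⟩, sub_zero, abs_of_pos hεpos]
  have m2 : dist (γ ε) z₂ = Real.pi - ε := by
    rw [← g1, hγ ε ⟨hεpos.le, hεpi.le⟩ _ ⟨hpi.le, le_refl _⟩, abs_sub_comm,
      abs_of_pos (by linarith)]
  rcases (hcurv.1 (γ ε) w).lt_or_eq with hd | hd
  · have := aux_pole_core hcurv z₁ z₂ w (γ ε) ε m1 m2 hz hεpos hεpi (by linarith) (by linarith) hd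
    linarith
  · obtain ⟨σ, s0, s1, hσ⟩ := aux_exists_geodesic hgeo w (γ ε)
    rw [dist_comm w, hd] at s1 hσ
    have hm : e / 4 ∈ Set.Icc 0 Real.pi := ⟨by linarith, by linarith⟩
    have w1 : dist (σ (e / 4)) w = e / 4 := by
      have := hσ (e / 4) hm 0 ⟨le_refl _, hpi.le⟩
      rw [s0, sub_zero, abs_of_pos (by linarith)] at this
      exact this
    have w2 : dist (γ ε) (σ (e / 4)) = Real.pi - e / 4 := by
      have := hσ Real.pi ⟨hpi.le, le_refl _⟩ (e / 4) hm
      rw [s1, abs_of_pos (by linarith)] at this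
      exact this
    have t1 := dist_triangle z₁ (σ (e / 4)) w
    have t2 := dist_triangle z₂ (σ (e / 4)) w
    have := aux_pole_core hcurv z₁ z₂ (σ (e / 4)) (γ ε) ε m1 m2 hz hεpos hεpi (by linarith)
      (by linarith) (by linarith)
    linarith

/-- Key estimate for one step along a geodesic. -/
lemma aux_step {X : Type*} [MetricSpace X] (hcurv : CurvCompGE1 X) (z q q' p : X)
    (s h δ : ℝ) (hs : dist q z = s) (hh : dist q q' = h) (hδ : dist q p = δ)
    (hzq : dist z q' = s + h) (s0 : 0 < s) (h0 : 0 < h) (δ0 : 0 < δ)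
    (hsδ : s + δ ≤ Real.pi) (hhδ : h + δ ≤ Real.pi) (hδ2 : δ ≤ Real.pi / 2)
    (hqc : Real.cos δ * Real.cos (dist p z) ≤ Real.cos s) :
    Real.cos h * Real.cos δ - Real.sin h * (Real.sin δ ^ 2 / Real.sin s) ≤
      Real.cos (dist q' p) := by
  have key := aux_sum_pi hcurv q z q' p (by linarith) (by linarith) (by linarith) (by linarith)
    (by linarith) (by linarith) (by linarith)
  have ta := dist_triangle z q p
  have tb := dist_triangle q' q p
  rw [dist_comm z q] at ta
  rw [dist_comm q' q] at tb
  rw [dist_comm p z] at hqc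
  rw [hs, hh, hδ] at key
  rw [hs, hδ] at ta
  rw [hh, hδ] at tb
  have ss := Real.sin_pos_of_pos_of_lt_pi s0 (by linarith)
  have sh := Real.sin_pos_of_pos_of_lt_pi h0 (by linarith)
  have sd := Real.sin_pos_of_pos_of_lt_pi δ0 (by linarith)
  have p1 : 0 < Real.sin s * Real.sin δ := mul_pos ss sd
  have p2 : 0 < Real.sin h * Real.sin δ := mul_pos sh sd
  have c1 := Real.cos_le_cos_of_nonneg_of_le_pi dist_nonneg hsδ ta
  have c2 := Real.cos_le_cos_of_nonneg_of_le_pi dist_nonneg hhδ tb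
  rw [Real.cos_add] at c1 c2
  have fin := aux_arccos (by rw [le_div_iff₀ p1]; linarith) (by rw [le_div_iff₀ p2]; linarith) key
  have cd : 0 ≤ Real.cos δ := Real.cos_nonneg_of_mem_Icc ⟨by linarith, hδ2⟩
  have ct := Real.cos_le_one (dist z p)
  generalize Real.cos (dist z p) = T at *
  generalize Real.cos (dist q' p) = D at *
  have sq := Real.sin_sq_add_cos_sq δ
  have bound : T - Real.cos s * Real.cos δ ≤ Real.sin δ ^ 2 := by
    nlinarith [mul_le_mul_of_nonneg_right hqc cd, mul_nonneg (sub_nonneg.2 ct) (sq_nonneg (Real.sin δ))]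
  have e1 : (T - Real.cos s * Real.cos δ) / (Real.sin s * Real.sin δ) ≤
      Real.sin δ ^ 2 / (Real.sin s * Real.sin δ) := div_le_div_of_nonneg_right bound p1.le
  have e2 : 0 ≤ (Real.sin δ ^ 2 / (Real.sin s * Real.sin δ) +
      (D - Real.cos h * Real.cos δ) / (Real.sin h * Real.sin δ)) * (Real.sin h * Real.sin δ) :=
    mul_nonneg (by linarith) p2.le
  have e3 : (Real.sin δ ^ 2 / (Real.sin s * Real.sin δ) +
      (D - Real.cos h * Real.cos δ) / (Real.sin h * Real.sin δ)) * (Real.sin h * Real.sin δ) =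
      Real.sin h * (Real.sin δ ^ 2 / Real.sin s) + (D - Real.cos h * Real.cos δ) := by
    field_simp
  linarith

lemma aux_local {X : Type*} [MetricSpace X] (hcurv : CurvCompGE1 X) (F : Set X)
    (hqc : IsQuasiConvex₁ F) (z : X) (hz : z ∈ F) (γ : ℝ → X) (s₀ η : ℝ) (hs₀ : 0 < s₀)
    (hη : 0 < η) (hη2 : s₀ + 2 * η ≤ Real.pi) 
    (hγ : ∀ s ∈ Set.Icc s₀ (s₀ + η), ∀ t ∈ Set.Icc s₀ (s₀ + η), dist (γ s) (γ t) = |s - t|)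
    (hγz : ∀ s ∈ Set.Icc s₀ (s₀ + η), dist z (γ s) = s)
    (hF : γ s₀ ∈ F) (hcomp : IsCompact (closedBall (γ s₀) (2 * η))) :
    ∀ s ∈ Set.Icc s₀ (s₀ + η), γ s ∈ F := by
  have hs0mem : s₀ ∈ Set.Icc s₀ (s₀ + η) := ⟨le_refl _, by linarith⟩
  have hpi := Real.pi_pos
  obtain ⟨x0, hx0, hmin⟩ := isCompact_Icc.exists_isMinOn (s := Set.Icc s₀ (s₀ + η)) ⟨s₀, hs0mem⟩
    Real.continuous_sin.continuousOn
  have hc : 0 < Real.sin x0 := Real.sin_pos_of_pos_of_lt_pi (by linarith [hx0.1]) (by linarith [hx0.2])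
  have hsin : ∀ s ∈ Set.Icc s₀ (s₀ + η), Real.sin x0 ≤ Real.sin s := fun s hs => hmin hs
  set c := Real.sin x0 with hcdef
  have hFne : F.Nonempty := ⟨z, hz⟩
  have hdle : ∀ s ∈ Set.Icc s₀ (s₀ + η), dist (γ s) (γ s₀) ≤ η := by
    intro s hs
    rw [hγ s hs s₀ hs0mem, abs_of_nonneg (by linarith [hs.1])]
    linarith [hs.2]
  have hfle : ∀ s ∈ Set.Icc s₀ (s₀ + η), infDist (γ s) F ≤ η := fun s hs =>
    (infDist_le_dist_of_mem hF).trans (hdle s hs)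
  have hnear : ∀ s ∈ Set.Icc s₀ (s₀ + η), ∃ p ∈ F, dist (γ s) p = infDist (γ s) F := by
    intro s hs
    obtain ⟨p, ⟨hpF, hpb⟩, hpmin⟩ := (hcomp.inter_left hqc.1).exists_isMinOn
      (f := fun y => dist (γ s) y) ⟨γ s₀, hF, by simp [hη.le]⟩ (by fun_prop)
    refine ⟨p, hpF, le_antisymm ?_ (infDist_le_dist_of_mem hpF)⟩
    rw [le_infDist hFne]
    intro y hy
    by_cases hyb : y ∈ closedBall (γ s₀) (2 * η)
    · exact hpmin ⟨hy, hyb⟩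
    · have h1 : dist (γ s) p ≤ dist (γ s) (γ s₀) := hpmin ⟨hF, by simp [hη.le]⟩
      have h2 := hdle s hs
      rw [mem_closedBall, not_le] at hyb
      have h3 := dist_triangle y (γ s) (γ s₀)
      rw [dist_comm y (γ s)] at h3
      linarith
  set g : ℝ → ℝ := fun s => 1 - Real.cos (infDist (γ s) F) with hg
  have hγc : ContinuousOn γ (Set.Icc s₀ (s₀ + η)) := by
    have : LipschitzOnWith 1 γ (Set.Icc s₀ (s₀ + η)) :=
      LipschitzOnWith.of_dist_le_mul (fun s hs t ht => by
        rw [hγ s hs t ht, Real.dist_eq]; simp)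
    exact this.continuousOn
  have hgc : ContinuousOn g (Set.Icc s₀ (s₀ + η)) := by
    refine continuousOn_const.sub (Real.continuous_cos.comp_continuousOn ?_)
    exact (continuous_infDist_pt F).comp_continuousOn hγc
  set K : ℝ := 2 / c with hK
  have hKpos : 0 < K := by positivity
  have hg0 : ∀ s, 0 ≤ g s := fun s => by simp only [hg]; linarith [Real.cos_le_one (infDist (γ s) F)]
  have hstep : ∀ s ∈ Set.Ico s₀ (s₀ + η), ∀ t ∈ Set.Ioc s (s₀ + η),
      g t ≤ 1 - Real.cos (t - s) * (1 - g s) + Real.sin (t - s) * (K * g s) := by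
    intro s hs t ht
    have hs' : s ∈ Set.Icc s₀ (s₀ + η) := ⟨hs.1, hs.2.le⟩
    have ht' : t ∈ Set.Icc s₀ (s₀ + η) := ⟨hs.1.trans ht.1.le, ht.2⟩
    have hst : dist (γ s) (γ t) = t - s := by
      rw [hγ s hs' t ht', abs_sub_comm, abs_of_pos (by linarith [ht.1])]
    have hts : 0 < t - s := by linarith [ht.1]
    have htsle : t - s ≤ η := by linarith [ht.2, hs.1]
    have hsh := Real.sin_pos_of_pos_of_lt_pi hts (by linarith)
    obtain ⟨p, hpF, hp⟩ := hnear s hs'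
    have hδle := hfle s hs'
    have hmono : Real.cos (dist (γ t) p) ≤ Real.cos (infDist (γ t) F) :=
      Real.cos_le_cos_of_nonneg_of_le_pi infDist_nonneg (hcurv.1 _ _) (infDist_le_dist_of_mem hpF)
    have hgs : g s = 1 - Real.cos (dist (γ s) p) := by simp only [hg]; rw [hp]
    have hgt : g t ≤ 1 - Real.cos (dist (γ t) p) := by simp only [hg]; linarith
    refine hgt.trans ?_
    by_cases hqF : γ s ∈ F
    · have h0 : dist (γ s) p = 0 := by rw [hp, infDist_zero_of_mem hqF]
      have h1 := dist_eq_zero.1 h0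
      rw [hgs, h0, Real.cos_zero, ← h1, dist_comm, hst]
      simp
    · have δ0 : 0 < dist (γ s) p := dist_pos.2 (fun h => hqF (h ▸ hpF))
      have hsz := hγz s hs'
      rw [← hp] at hδle
      have h2 := aux_step hcurv z (γ s) (γ t) p s (t - s) (dist (γ s) p) (by rw [dist_comm, hsz])
        hst rfl (by rw [hγz t ht']; ring) (by linarith [hs.1]) hts δ0 (by linarith [hs.2])
        (by linarith) (by linarith) (by
          have := hqc.2 (γ s) p hqF hpF hp z hz
          rwa [dist_comm (γ s) z, hsz] at this)
      have h3 : Real.sin (dist (γ s) p) ^ 2 / Real.sin s ≤ K * g s := by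
        have hcs := hsin s hs'
        have h4 : Real.sin (dist (γ s) p) ^ 2 ≤ 2 * g s := by
          rw [hgs]
          nlinarith [Real.sin_sq_add_cos_sq (dist (γ s) p), Real.cos_le_one (dist (γ s) p),
            Real.neg_one_le_cos (dist (γ s) p)]
        calc Real.sin (dist (γ s) p) ^ 2 / Real.sin s ≤ (2 * g s) / c :=
              div_le_div₀ (by linarith [hg0 s]) h4 hc hcs
          _ = K * g s := by rw [hK]; ring
      have h5 := mul_le_mul_of_nonneg_left h3 hsh.le
      have h6 : 1 - g s = Real.cos (dist (γ s) p) := by rw [hgs]; ring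
      rw [h6]
      linarith
  have gron := le_gronwallBound_of_liminf_deriv_right_le (f := g) (f' := fun s => K * g s)
    (δ := 0) (K := K) (ε := 0) (a := s₀) (b := s₀ + η) hgc (by
      intro s hs r hr
      set U : ℝ → ℝ := fun t => 1 - Real.cos (t - s) * (1 - g s) + Real.sin (t - s) * (K * g s) with hU
      have hd : HasDerivAt U (K * g s) s := by
        have e1 : HasDerivAt (fun t : ℝ => t - s) 1 s := (hasDerivAt_id s).sub_const s
        have e2 := ((e1.cos.mul_const (1 - g s)).const_sub 1).add (e1.sin.mul_const (K * g s))
        refine HasDerivAt.congr_deriv (f' := _) e2 ?_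
        simp
      have hfr := hd.hasDerivWithinAt.liminf_right_slope_le hr
      have hev : ∀ᶠ t in nhdsWithin s (Set.Ioi s), t ∈ Set.Ioc s (s₀ + η) :=
        Ioc_mem_nhdsGT hs.2
      refine (hfr.and_eventually hev).mono ?_
      rintro t ⟨h1, h2⟩
      refine lt_of_le_of_lt ?_ h1
      have hUs : U s = g s := by simp [hU]
      have hle := hstep s hs t h2
      have : 0 ≤ (t - s)⁻¹ := inv_nonneg.2 (by linarith [h2.1])
      rw [slope_def_field, div_eq_inv_mul, hUs]
      exact mul_le_mul_of_nonneg_left (by linarith) this) (by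
      simp only [hg]; rw [infDist_zero_of_mem hF]; simp) (by intro s _; simp)
  intro s hs
  have h1 := gron s hs
  rw [gronwallBound_ε0_δ0] at h1
  have h2 : infDist (γ s) F = 0 := by
    by_contra hne
    have hpos := lt_of_le_of_ne infDist_nonneg (Ne.symm hne)
    have h3 := Real.cos_lt_cos_of_nonneg_of_le_pi (le_refl 0)
      (by linarith [hfle s hs] : infDist (γ s) F ≤ Real.pi) hpos
    rw [Real.cos_zero] at h3
    simp only [hg] at h1
    linarith
  exact (hqc.1.mem_iff_infDist_zero hFne).2 h2

lemma aux_main {X : Type*} [MetricSpace X] [CompleteSpace X] [LocallyCompactSpace X]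
    (hgeo : GeodesicSpace X) (hcurv : CurvCompGE1 X) (F : Set X)
    (hqc : IsQuasiConvex₁ F) (z : X) (hz : z ∈ F) (r x : X) (hr : r ∈ F) (hzr : 0 < dist z r)
    (h : dist z x = dist z r + dist r x) : x ∈ F := by
  by_contra hx
  obtain ⟨σ, hσ0, hσ1, hσ⟩ := aux_exists_geodesic hgeo r x
  set a := dist z r with ha
  set L := dist r x with hL
  have hL0 : 0 ≤ L := dist_nonneg
  have hσc : ContinuousOn σ (Set.Icc 0 L) := by
    have : LipschitzOnWith 1 σ (Set.Icc 0 L) :=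
      LipschitzOnWith.of_dist_le_mul (fun s hs t ht => by
        rw [hσ s hs t ht, Real.dist_eq]; simp)
    exact this.continuousOn
  have hcl : IsClosed (Set.Icc 0 L ∩ σ ⁻¹' F) := hσc.preimage_isClosed_of_isClosed isClosed_Icc hqc.1
  have hco : IsCompact (Set.Icc 0 L ∩ σ ⁻¹' F) :=
    isCompact_Icc.of_isClosed_subset hcl Set.inter_subset_left
  obtain ⟨u, ⟨huI, huF⟩, humax⟩ := hco.exists_isGreatest
    ⟨0, ⟨le_refl _, hL0⟩, by simpa [hσ0] using hr⟩
  have huL : u < L := lt_of_le_of_ne huI.2 (fun he => hx (by rw [← hσ1, ← he]; exact huF))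
  have haL : a + L ≤ Real.pi := by rw [← h]; exact hcurv.1 _ _
  obtain ⟨K, hKc, hKn⟩ := exists_compact_mem_nhds (σ u)
  obtain ⟨ρ, hρ, hρK⟩ := Metric.nhds_basis_closedBall.mem_iff.1 hKn
  set η := min (ρ / 2) ((L - u) / 2) with hη
  have hηpos : 0 < η := lt_min (by linarith) (by linarith)
  have hη1 : η ≤ ρ / 2 := min_le_left _ _
  have hη2 : η ≤ (L - u) / 2 := min_le_right _ _
  have hzσ : ∀ t ∈ Set.Icc 0 L, dist z (σ t) = a + t := by
    intro t ht
    have d1 := hσ 0 ⟨le_refl _, hL0⟩ t ht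
    have d2 := hσ t ht L ⟨hL0, le_refl _⟩
    rw [hσ0, abs_sub_comm, sub_zero, abs_of_nonneg ht.1] at d1
    rw [hσ1, abs_sub_comm, abs_of_nonneg (by linarith [ht.2])] at d2
    have t1 := dist_triangle z r (σ t)
    have t2 := dist_triangle z (σ t) x
    linarith
  have hshift : ∀ s ∈ Set.Icc (a + u) (a + u + η), s - a ∈ Set.Icc 0 L := by
    intro s hs
    exact ⟨by linarith [hs.1, huI.1], by linarith [hs.2]⟩
  have hua : σ (a + u - a) = σ u := by congr 1; ring
  have hfin := aux_local hcurv F hqc z hz (fun s => σ (s - a)) (a + u) η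
    (by linarith [huI.1]) hηpos (by linarith) (by
      intro s hs t ht
      rw [hσ _ (hshift s hs) _ (hshift t ht)]; congr 1; ring) (by
      intro s hs
      rw [hzσ _ (hshift s hs)]; ring) (by simp only [hua]; exact huF) (by
      simp only [hua]
      exact hKc.of_isClosed_subset isClosed_closedBall
        ((closedBall_subset_closedBall (by linarith)).trans hρK))
    (a + u + η) ⟨by linarith, le_refl _⟩
  have hmem : a + u + η - a ∈ Set.Icc 0 L ∩ σ ⁻¹' F :=
    ⟨hshift _ ⟨by linarith, le_refl _⟩, hfin⟩
  have := humax hmem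
  linarith

/-- If a quasi-convex subset `F` of a spherical suspension contains the pole `z₁` and another
point, then it contains the opposite pole `z₂`, and for every `r ∈ F` the whole minimal geodesic
from `z₁` to `z₂` through `r` lies in `F`. -/
theorem quasiConvex_contains_pole_geodesics {X : Type*} [MetricSpace X] [CompleteSpace X]
    [LocallyCompactSpace X]
    (hdim : dimH (Set.univ : Set X) < ⊤)
    (hgeo : GeodesicSpace X)
    (hdiam : ∀ x y : X, dist x y ≤ Real.pi)
    (hcurv : CurvCompGE1 X)
    (z₁ z₂ : X) (hz : dist z₁ z₂ = Real.pi)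
    (F : Set X) (hqc : IsQuasiConvex₁ F)
    (hz₁ : z₁ ∈ F) (hother : ∃ w ∈ F, w ≠ z₁) :
    z₂ ∈ F ∧
      ∀ r ∈ F, 0 < dist z₁ r → dist z₁ r < Real.pi →
        ∀ x : X, dist z₁ x + dist x z₂ = Real.pi →
          dist x r = |dist z₁ x - dist z₁ r| → x ∈ F := by
  have hpole := aux_pole hgeo hcurv z₁ z₂ hz
  have hz₂ : z₂ ∈ F := by
    obtain ⟨w, hw, hne⟩ := hother
    refine aux_main hgeo hcurv F hqc z₁ hz₁ w z₂ hw (dist_pos.2 hne.symm) ?_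
    rw [hz, dist_comm w, hpole w]
  refine ⟨hz₂, ?_⟩
  intro r hr h0 hpi x hx hxr
  have hpr := hpole r
  rw [dist_comm x z₂] at hx
  rcases le_total (dist z₁ r) (dist z₁ x) with h | h
  · refine aux_main hgeo hcurv F hqc z₁ hz₁ r x hr h0 ?_
    rw [dist_comm r x, hxr, abs_of_nonneg (by linarith)]; ring
  · refine aux_main hgeo hcurv F hqc z₂ hz₂ r x hr (by linarith) ?_
    rw [dist_comm r x, hxr, abs_of_nonpos (by linarith)]; linarith
end

section
/- Let Z be a metric space, let m ∈ ℕ, and let (X_n) be a sequence of nonempty compact subsets of Z and X a nonempty compact subset of Z such that the Hausdorff distance between X_n and X tends to 0. Assume each X_n, with the metric induced from Z, is a geodesic space of Hausdorff dimension at most m whose metric has curvature ≥ 0 in the comparison sense, and that X with the induced metric is geodesic. Let F_n ⊆ X_n be nonempty quasi-convex subsets of X_n, and let F be a nonempty closed subset of X such that the Hausdorff distance between F_n and F tends to 0. Then F is a quasi-convex subset of X. -/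
open Metric

/-- Euclidean comparison angle at `p` between `x` and `y`. -/
noncomputable def compAngle₀ {X : Type*} [MetricSpace X] (x p y : X) : ℝ :=
  Real.arccos ((dist p x ^ 2 + dist p y ^ 2 - dist x y ^ 2) / (2 * dist p x * dist p y))

/-- `X` has curvature `≥ 0` in the comparison sense. -/
def CurvCompGE0 (X : Type*) [MetricSpace X] : Prop :=
  ∀ p a b c : X, a ≠ p → b ≠ p → c ≠ p →
    compAngle₀ a p b + compAngle₀ b p c + compAngle₀ c p a ≤ 2 * Real.pi

/-- `F` is a quasi-convex subset of `X` (comparison-angle formulation, curvature `≥ 0`). -/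
def IsQuasiConvex {X : Type*} [MetricSpace X] (F : Set X) : Prop :=
  IsClosed F ∧
    ∀ q p : X, q ∉ F → p ∈ F → dist q p = infDist q F →
      ∀ r ∈ F, dist q r ^ 2 ≤ dist q p ^ 2 + dist p r ^ 2

open Filter Topology in
lemma tendsto_compAngle_aux {Z : Type*} [MetricSpace Z] {x p y : ℕ → Z} {x' p' y' : Z}
    (hx : Tendsto x atTop (𝓝 x')) (hp : Tendsto p atTop (𝓝 p')) (hy : Tendsto y atTop (𝓝 y'))
    (h1 : x' ≠ p') (h2 : y' ≠ p') :
    Tendsto (fun n => compAngle₀ (x n) (p n) (y n)) atTop (𝓝 (compAngle₀ x' p' y')) := by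
  unfold compAngle₀
  refine (Real.continuous_arccos.tendsto _).comp (Tendsto.div ?_ ?_ ?_)
  · exact (((hp.dist hx).pow 2).add ((hp.dist hy).pow 2)).sub ((hx.dist hy).pow 2)
  · exact ((hp.dist hx).const_mul 2).mul (hp.dist hy)
  · have a := dist_pos.2 h1.symm
    have b := dist_pos.2 h2.symm
    positivity

lemma compAngle_eq_pi_aux {Z : Type*} [MetricSpace Z] {x p y : Z}
    (h1 : x ≠ p) (h2 : y ≠ p) (h : dist x y = dist p x + dist p y) :
    compAngle₀ x p y = Real.pi := by
  have a := dist_pos.2 h1.symm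
  have b := dist_pos.2 h2.symm
  unfold compAngle₀
  rw [h, ← Real.arccos_neg_one]
  congr 1
  field_simp
  ring

open Filter Topology in
lemma exists_seq_aux {Z : Type*} [MetricSpace Z] {A : ℕ → Set Z} {B : Set Z}
    (hA : ∀ n, (A n).Nonempty) (hAb : ∀ n, Bornology.IsBounded (A n))
    (hBb : Bornology.IsBounded B)
    (h : Tendsto (fun n => hausdorffDist (A n) B) atTop (𝓝 0)) {x : Z} (hx : x ∈ B) :
    ∃ u : ℕ → Z, (∀ n, u n ∈ A n) ∧ Tendsto u atTop (𝓝 x) := by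
  have key : ∀ n, ∃ y ∈ A n, dist y x < hausdorffDist (A n) B + 1 / ((n : ℝ) + 1) := by
    intro n
    have hpos : (0 : ℝ) < 1 / ((n : ℝ) + 1) := by positivity
    exact exists_dist_lt_of_hausdorffDist_lt' hx (lt_add_of_pos_right _ hpos)
      (hausdorffEDist_ne_top_of_nonempty_of_bounded (hA n) ⟨x, hx⟩ (hAb n) hBb)
  choose u hu hd using key
  refine ⟨u, hu, tendsto_iff_dist_tendsto_zero.2 ?_⟩
  have hl : Tendsto (fun n : ℕ => hausdorffDist (A n) B + 1 / ((n : ℝ) + 1)) atTop (𝓝 0) := by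
    simpa using h.add tendsto_one_div_add_atTop_nhds_zero_nat
  exact squeeze_zero (fun _ => dist_nonneg) (fun n => (hd n).le) hl

open Filter Topology in
lemma exists_subseq_aux {Z : Type*} [MetricSpace Z] {A : ℕ → Set Z} {B : Set Z}
    (hAb : ∀ n, Bornology.IsBounded (A n)) (hB : IsCompact B) (hBn : B.Nonempty)
    (h : Tendsto (fun n => hausdorffDist (A n) B) atTop (𝓝 0)) {u : ℕ → Z}
    (hu : ∀ n, u n ∈ A n) :
    ∃ x ∈ B, ∃ φ : ℕ → ℕ, StrictMono φ ∧ Tendsto (u ∘ φ) atTop (𝓝 x) := by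
  have key : ∀ n, ∃ y ∈ B, dist (u n) y < hausdorffDist (A n) B + 1 / ((n : ℝ) + 1) := by
    intro n
    have hpos : (0 : ℝ) < 1 / ((n : ℝ) + 1) := by positivity
    exact exists_dist_lt_of_hausdorffDist_lt (hu n) (lt_add_of_pos_right _ hpos)
      (hausdorffEDist_ne_top_of_nonempty_of_bounded ⟨_, hu n⟩ hBn (hAb n) hB.isBounded)
  choose v hv hd using key
  obtain ⟨x, hx, φ, hφ, hlim⟩ := hB.tendsto_subseq hv
  refine ⟨x, hx, φ, hφ, tendsto_iff_dist_tendsto_zero.2 ?_⟩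
  have hl : Tendsto (fun n : ℕ => hausdorffDist (A n) B + 1 / ((n : ℝ) + 1)) atTop (𝓝 0) := by
    simpa using h.add tendsto_one_div_add_atTop_nhds_zero_nat
  have hl2 := (hl.comp hφ.tendsto_atTop).add (tendsto_iff_dist_tendsto_zero.1 hlim)
  rw [add_zero] at hl2
  refine squeeze_zero (fun _ => dist_nonneg) (fun n => ?_) hl2
  exact (dist_triangle _ (v (φ n)) _).trans (add_le_add (hd (φ n)).le le_rfl)

open Filter Topology in
/-- points on a geodesic from `q` to `p` approaching `q`. -/
lemma exists_geod_aux {Y : Type*} [MetricSpace Y] (hY : GeodesicSpace Y) (q p : Y) :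
    ∃ u : ℕ → Y, ∀ k, dist q (u k) = dist q p / 2 ^ k ∧
      dist (u k) p = dist q p - dist q p / 2 ^ k := by
  choose mid h1 h2 using hY
  refine ⟨fun k => Nat.rec p (fun _ z => mid q z) k, fun k => ?_⟩
  induction k with
  | zero => simp
  | succ k ih =>
    obtain ⟨i1, i2⟩ := ih
    simp only at i1 i2 ⊢
    set z : Y := Nat.rec p (fun _ z => mid q z) k
    have e1 : dist q (mid q z) = dist q p / 2 ^ (k + 1) := by
      rw [h1, i1, pow_succ]; field_simp
    have e2 : dist (mid q z) z = dist q p / 2 ^ (k + 1) := by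
      rw [h2, i1, pow_succ]; field_simp
    have e3 : dist q p / 2 ^ k = 2 * (dist q p / 2 ^ (k + 1)) := by
      rw [pow_succ]; field_simp
    refine ⟨e1, le_antisymm ?_ ?_⟩
    · have := dist_triangle (mid q z) z p
      linarith
    · have := dist_triangle q (mid q z) p
      linarith

/-- Stability of quasi-convexity under (non-collapsing) Hausdorff convergence of compact
subspaces of an ambient metric space. -/
theorem quasiConvex_of_hausdorff_limit {Z : Type*} [MetricSpace Z] (m : ℕ)
    (Xn : ℕ → Set Z) (X : Set Z)
    (hXn_ne : ∀ n, (Xn n).Nonempty) (hXn_cpt : ∀ n, IsCompact (Xn n))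
    (hX_ne : X.Nonempty) (hX_cpt : IsCompact X)
    (hXconv : Filter.Tendsto (fun n => hausdorffDist (Xn n) X) Filter.atTop (nhds 0))
    (hgeo : ∀ n, GeodesicSpace ↥(Xn n))
    (hdim : ∀ n, dimH (Xn n) ≤ (m : ENNReal))
    (hcurv : ∀ n, CurvCompGE0 ↥(Xn n))
    (hXgeo : GeodesicSpace ↥X)
    (Fn : ℕ → Set Z) (hFn_sub : ∀ n, Fn n ⊆ Xn n) (hFn_ne : ∀ n, (Fn n).Nonempty)
    (hFn_qc : ∀ n, IsQuasiConvex ((Subtype.val ⁻¹' Fn n) : Set ↥(Xn n)))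
    (F : Set Z) (hF_sub : F ⊆ X) (hF_ne : F.Nonempty)
    (hF_closed : IsClosed ((Subtype.val ⁻¹' F) : Set ↥X))
    (hFconv : Filter.Tendsto (fun n => hausdorffDist (Fn n) F) Filter.atTop (nhds 0)) :
    IsQuasiConvex ((Subtype.val ⁻¹' F) : Set ↥X) := by
  classical
  have hFcpt : IsCompact F := by
    have : CompactSpace X := isCompact_iff_compactSpace.1 hX_cpt
    have h := hF_closed.isCompact.image continuous_subtype_val
    rwa [Subtype.image_preimage_coe, Set.inter_eq_right.2 hF_sub] at h
  have hFnb : ∀ n, Bornology.IsBounded (Fn n) := fun n => (hXn_cpt n).isBounded.subset (hFn_sub n)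
  have hXnb : ∀ n, Bornology.IsBounded (Xn n) := fun n => (hXn_cpt n).isBounded
  refine ⟨hF_closed, ?_⟩
  intro q p hq hp hqp r hr
  have hpq : q ≠ p := fun h => hq (h ▸ hp)
  have hD : 0 < dist q p := dist_pos.2 hpq
  have hmin : ∀ z ∈ F, dist (q : Z) p ≤ dist (q : Z) z := by
    intro z hz
    have h := infDist_le_dist_of_mem (x := q) (s := (Subtype.val ⁻¹' F : Set X))
      (y := ⟨z, hF_sub hz⟩) hz
    rw [← hqp] at h
    exact h
  -- the claim for interior points of a geodesic
  have main : ∀ t : Z, t ∈ X → 0 < dist (q : Z) t → 0 < dist t p →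
      dist (q : Z) t + dist t p = dist (q : Z) p →
      dist t r ^ 2 ≤ dist t p ^ 2 + dist (p : Z) r ^ 2 := by
    intro t ht hqt htp hsum
    obtain ⟨qs, hqs, hqs'⟩ := exists_seq_aux hXn_ne hXnb hX_cpt.isBounded hXconv q.2
    obtain ⟨ts, hts, hts'⟩ := exists_seq_aux hXn_ne hXnb hX_cpt.isBounded hXconv ht
    obtain ⟨ss, hss, hss'⟩ := exists_seq_aux hFn_ne hFnb hFcpt.isBounded hFconv hp
    obtain ⟨rs, hrs, hrs'⟩ := exists_seq_aux hFn_ne hFnb hFcpt.isBounded hFconv hr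
    have hclose : ∀ n, ∃ y : Xn n, (y : Z) ∈ Fn n ∧
        infDist (⟨ts n, hts n⟩ : Xn n) (Subtype.val ⁻¹' Fn n) =
          dist (⟨ts n, hts n⟩ : Xn n) y := by
      intro n
      have : CompactSpace (Xn n) := isCompact_iff_compactSpace.1 (hXn_cpt n)
      obtain ⟨y, hy⟩ := hFn_ne n
      obtain ⟨w, hw, e⟩ := (hFn_qc n).1.isCompact.exists_infDist_eq_dist
        ⟨⟨y, hFn_sub n hy⟩, hy⟩ (⟨ts n, hts n⟩ : Xn n)
      exact ⟨w, hw, e⟩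
    choose ps hps hpd using hclose
    have hle : ∀ n, dist (ts n) (ps n) ≤ dist (ts n) (ss n) := by
      intro n
      have h := infDist_le_dist_of_mem (x := (⟨ts n, hts n⟩ : Xn n))
        (s := (Subtype.val ⁻¹' Fn n : Set (Xn n)))
        (y := ⟨ss n, hFn_sub n (hss n)⟩) (hss n)
      rw [hpd] at h
      exact h
    obtain ⟨p', hp', φ, hφ, hlim⟩ := exists_subseq_aux hFnb hFcpt hF_ne hFconv
      (u := fun n => (ps n : Z)) hps
    have hφt := hφ.tendsto_atTop
    have Lq := hqs'.comp hφt
    have Lt := hts'.comp hφt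
    have Ls := hss'.comp hφt
    have Lr := hrs'.comp hφt
    have h1 : dist t p' ≤ dist t p :=
      le_of_tendsto_of_tendsto' (Lt.dist hlim) (Lt.dist Ls) (fun n => hle (φ n))
    have h2 := hmin p' hp'
    have h3 := dist_triangle (q : Z) t p'
    have htp' : dist t p' = dist t p := by linarith
    have hqp' : dist (q : Z) p' = dist (q : Z) p := by linarith
    have nqt : (q : Z) ≠ t := dist_pos.1 hqt
    have npt : (p : Z) ≠ t := (dist_pos.1 htp).symm
    have npt2 : p' ≠ t := by
      rw [← htp'] at htp
      exact (dist_pos.1 htp).symm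
    have hang : compAngle₀ (q : Z) t p + compAngle₀ (p : Z) t p' + compAngle₀ p' t q
        ≤ 2 * Real.pi := by
      refine le_of_tendsto (((tendsto_compAngle_aux Lq Lt Ls nqt npt).add
        (tendsto_compAngle_aux Ls Lt hlim npt npt2)).add
        (tendsto_compAngle_aux hlim Lt Lq npt2 nqt)) ?_
      filter_upwards [(Lq.dist Lt).eventually_ne (dist_ne_zero.2 nqt),
        (Ls.dist Lt).eventually_ne (dist_ne_zero.2 npt),
        (hlim.dist Lt).eventually_ne (dist_ne_zero.2 npt2)] with n a b c
      exact hcurv (φ n) ⟨ts (φ n), hts _⟩ ⟨qs (φ n), hqs _⟩ ⟨ss (φ n), hFn_sub _ (hss _)⟩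
        (ps (φ n)) (fun h => dist_ne_zero.1 a (congrArg Subtype.val h))
        (fun h => dist_ne_zero.1 b (congrArg Subtype.val h))
        (fun h => dist_ne_zero.1 c (congrArg Subtype.val h))
    rw [compAngle_eq_pi_aux nqt npt (by rw [dist_comm t]; exact hsum.symm),
      compAngle_eq_pi_aux npt2 nqt (by
        rw [dist_comm p', hqp', htp', dist_comm t q]; linarith)] at hang
    have h0 : compAngle₀ (p : Z) t p' ≤ 0 := by linarith
    unfold compAngle₀ at h0
    have h0' := Real.arccos_eq_zero.1 (le_antisymm h0 (Real.arccos_nonneg _))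
    rw [htp', le_div_iff₀ (by positivity)] at h0'
    have hpp' : (p : Z) = p' := by
      apply dist_eq_zero.1
      have : dist (p : Z) p' ^ 2 = 0 := le_antisymm (by nlinarith) (sq_nonneg _)
      exact pow_eq_zero_iff (two_ne_zero) |>.1 this
    rw [← hpp'] at hlim
    refine le_of_tendsto_of_tendsto ((Lt.dist Lr).pow 2)
      (((Lt.dist hlim).pow 2).add ((hlim.dist Lr).pow 2)) ?_
    filter_upwards [(Lt.dist hlim).eventually_ne htp.ne'] with n hn
    refine (hFn_qc (φ n)).2 ⟨ts (φ n), hts _⟩ (ps (φ n)) ?_ (hps _) (hpd _).symm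
      ⟨rs (φ n), hFn_sub _ (hrs _)⟩ (hrs _)
    intro hmem
    have h := infDist_zero_of_mem hmem
    rw [hpd] at h
    exact hn h
  obtain ⟨u, hu⟩ := exists_geod_aux hXgeo q p
  have hpow : Filter.Tendsto (fun k : ℕ => dist q p / 2 ^ k) Filter.atTop (nhds 0) := by
    have h := (tendsto_pow_atTop_nhds_zero_of_lt_one (r := (1 / 2 : ℝ)) (by norm_num)
      (by norm_num)).const_mul (dist q p)
    simpa [div_eq_mul_inv] using h
  have hulim : Filter.Tendsto u Filter.atTop (nhds q) := by
    rw [tendsto_iff_dist_tendsto_zero]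
    refine hpow.congr fun k => ?_
    rw [dist_comm (u k) q, (hu k).1]
  refine le_of_tendsto_of_tendsto ((hulim.dist tendsto_const_nhds).pow 2)
    (((hulim.dist tendsto_const_nhds).pow 2).add tendsto_const_nhds) ?_
  filter_upwards [Filter.eventually_ge_atTop 1] with k hk
  have hlt : dist q p / 2 ^ k < dist q p :=
    div_lt_self hD (one_lt_pow₀ (by norm_num) (by omega))
  have e1 : dist (q : Z) (u k) = dist q p / 2 ^ k := (hu k).1
  have e2 : dist (u k : Z) p = dist q p - dist q p / 2 ^ k := (hu k).2
  have e3 : dist (q : Z) p = dist q p := rfl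
  exact main (u k) (u k).2 (by rw [e1]; positivity) (by rw [e2]; linarith)
    (by rw [e1, e2, e3]; ring)
end

section
/- Let X be a compact geodesic metric space of finite Hausdorff dimension whose metric has curvature ≥ 0 in the comparison sense. Then there exists ε > 0, depending only on X, such that for any two distinct points p, q ∈ X with d(p,q) < ε², at least one of the following holds: (i) for every δ > 0 there exists x ∈ X with 0 < d(q,x) < δ and d(p,x) > d(p,q) + ε·d(q,x); or (ii) for every δ > 0 there exists x ∈ X with 0 < d(p,x) < δ and d(q,x) > d(p,q) + ε·d(p,x). (This is the metric rendering of: the maximal directional derivative of dist_p at q, or of dist_q at p, exceeds ε.) -/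
open Metric

/-- Points dividing a pair in a dyadic ratio. -/
theorem dyadic_point {X : Type*} [MetricSpace X] (hgeo : GeodesicSpace X) (n : ℕ) :
    ∀ (x y : X) (k : ℕ), k ≤ 2 ^ n →
      ∃ z : X, dist x z = (k / 2 ^ n : ℝ) * dist x y ∧
        dist z y = (1 - k / 2 ^ n : ℝ) * dist x y := by
  induction n with
  | zero =>
    intro x y k hk
    have : k = 0 ∨ k = 1 := by simp at hk; omega
    rcases this with rfl | rfl
    · exact ⟨x, by simp, by simp⟩
    · exact ⟨y, by simp, by simp⟩
  | succ n ih =>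
    intro x y k hk
    obtain ⟨m, h1, h2⟩ := hgeo x y
    rcases le_total k (2 ^ n) with h | h
    · obtain ⟨z, hz1, hz2⟩ := ih x m k h
      have e1 : dist x z = (k / 2 ^ (n + 1) : ℝ) * dist x y := by
        rw [hz1, h1, pow_succ]; field_simp
      refine ⟨z, e1, ?_⟩
      have t1 := dist_triangle x z y
      have t2 := dist_triangle z m y
      have e2 : dist z m = dist x y / 2 - (k / 2 ^ (n + 1) : ℝ) * dist x y := by
        rw [hz2, h1, pow_succ]; field_simp
      linarith
    · obtain ⟨j, rfl⟩ := Nat.exists_eq_add_of_le h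
      have hj : j ≤ 2 ^ n := by rw [pow_succ] at hk; omega
      obtain ⟨z, hz1, hz2⟩ := ih m y j hj
      have e1 : dist z y = (1 - ((2 ^ n + j : ℕ) : ℝ) / 2 ^ (n + 1) : ℝ) * dist x y := by
        rw [hz2, h2, pow_succ]; push_cast; field_simp; ring
      refine ⟨z, ?_, e1⟩
      have t1 := dist_triangle x z y
      have t2 := dist_triangle x m z
      have e2 : dist m z = ((2 ^ n + j : ℕ) : ℝ) / 2 ^ (n + 1) * dist x y - dist x y / 2 := by
        rw [hz1, h2, pow_succ]; push_cast; field_simp; ring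
      linarith

/-- Points dividing a pair in an arbitrary ratio. -/
theorem ratio_point {X : Type*} [MetricSpace X] [CompactSpace X] (hgeo : GeodesicSpace X)
    (x y : X) (l : ℝ) (h0 : 0 ≤ l) (h1 : l ≤ 1) :
    ∃ z : X, dist x z = l * dist x y ∧ dist z y = (1 - l) * dist x y := by
  have key : ∀ n : ℕ, ∃ z : X, |dist x z - l * dist x y| ≤ dist x y * (1 / 2) ^ n ∧
      |dist z y - (1 - l) * dist x y| ≤ dist x y * (1 / 2) ^ n := by
    intro n
    have hp : (0 : ℝ) < 2 ^ n := by positivity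
    have hk : ⌊l * 2 ^ n⌋₊ ≤ 2 ^ n := by
      have : (⌊l * 2 ^ n⌋₊ : ℝ) ≤ l * 2 ^ n := Nat.floor_le (by positivity)
      have h2 : (⌊l * 2 ^ n⌋₊ : ℝ) ≤ ((2 ^ n : ℕ) : ℝ) := by push_cast; nlinarith
      exact_mod_cast h2
    obtain ⟨z, hz1, hz2⟩ := dyadic_point hgeo n x y _ hk
    have a1 : (⌊l * 2 ^ n⌋₊ : ℝ) / 2 ^ n ≤ l := by
      rw [div_le_iff₀ hp]; exact Nat.floor_le (by positivity)
    have a2 : l - (1 / 2) ^ n ≤ (⌊l * 2 ^ n⌋₊ : ℝ) / 2 ^ n := by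
      rw [le_div_iff₀ hp, sub_mul]
      have := Nat.lt_floor_add_one (l * 2 ^ n)
      have e : ((1 : ℝ) / 2) ^ n * 2 ^ n = 1 := by rw [← mul_pow]; norm_num
      linarith
    have hd := dist_nonneg (x := x) (y := y)
    refine ⟨z, ?_, ?_⟩ <;> rw [abs_le] <;> constructor <;> (try rw [hz1]) <;> (try rw [hz2]) <;>
      nlinarith [show (0 : ℝ) < (1 / 2) ^ n by positivity]
  choose z hz1 hz2 using key
  obtain ⟨w, -, φ, hφ, hw⟩ := isCompact_univ.tendsto_subseq (fun n => Set.mem_univ (z n))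
  have lim0 : Filter.Tendsto (fun n => dist x y * (1 / 2 : ℝ) ^ (φ n)) Filter.atTop (nhds 0) := by
    have := (tendsto_pow_atTop_nhds_zero_of_lt_one (r := (1 / 2 : ℝ)) (by norm_num)
      (by norm_num)).const_mul (dist x y)
    rw [mul_zero] at this
    exact this.comp hφ.tendsto_atTop
  refine ⟨w, ?_, ?_⟩
  · have t : Filter.Tendsto (fun n => |dist x (z (φ n)) - l * dist x y|) Filter.atTop
        (nhds |dist x w - l * dist x y|) :=
      ((tendsto_const_nhds.dist hw).sub_const _).abs
    have := le_of_tendsto_of_tendsto' t lim0 (fun n => hz1 (φ n))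
    exact sub_eq_zero.1 (abs_eq_zero.1 (le_antisymm this (abs_nonneg _)))
  · have t : Filter.Tendsto (fun n => |dist (z (φ n)) y - (1 - l) * dist x y|) Filter.atTop
        (nhds |dist w y - (1 - l) * dist x y|) :=
      ((hw.dist tendsto_const_nhds).sub_const _).abs
    have := le_of_tendsto_of_tendsto' t lim0 (fun n => hz2 (φ n))
    exact sub_eq_zero.1 (abs_eq_zero.1 (le_antisymm this (abs_nonneg _)))

/-- The argument of the comparison angle is at most one in absolute value. -/
theorem comp_arg_bounds {X : Type*} [MetricSpace X] (x p y : X) (hx : x ≠ p) (hy : y ≠ p) :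
    -1 ≤ (dist p x ^ 2 + dist p y ^ 2 - dist x y ^ 2) / (2 * dist p x * dist p y) ∧
    (dist p x ^ 2 + dist p y ^ 2 - dist x y ^ 2) / (2 * dist p x * dist p y) ≤ 1 := by
  have h1 : 0 < dist p x := dist_pos.2 hx.symm
  have h2 : 0 < dist p y := dist_pos.2 hy.symm
  have t1 := dist_triangle x p y
  have t2 := dist_triangle p x y
  have t3 := dist_triangle p y x
  rw [dist_comm x p] at t1
  rw [dist_comm y x] at t3
  have := dist_nonneg (x := x) (y := y)
  constructor
  · rw [le_div_iff₀ (by positivity)]; nlinarith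
  · rw [div_le_iff₀ (by positivity)]
    have : |dist p x - dist p y| ≤ |dist x y| := by
      rw [abs_of_nonneg this, abs_le]; constructor <;> linarith
    have := sq_le_sq.2 this
    nlinarith

/-- Concavity of squared distance functions. -/
theorem concave_ineq {X : Type*} [MetricSpace X] (hcurv : CurvCompGE0 X)
    (p x y z : X) (l : ℝ) (h0 : 0 ≤ l) (h1 : l ≤ 1)
    (hz1 : dist p z = l * dist p x) (hz2 : dist z x = (1 - l) * dist p x) :
    (1 - l) * dist y p ^ 2 + l * dist y x ^ 2 - l * (1 - l) * dist p x ^ 2 ≤ dist y z ^ 2 := by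
  by_cases hzp : z = p
  · subst hzp
    rw [dist_self] at hz1
    rcases mul_eq_zero.1 hz1.symm with h | h
    · subst h; simp
    · rw [dist_eq_zero.1 h]; simp
      nlinarith
  by_cases hzx : z = x
  · subst hzx
    rw [dist_self] at hz2
    rcases mul_eq_zero.1 hz2.symm with h | h
    · have : l = 1 := by linarith
      subst this; simp
    · rw [dist_eq_zero.1 h]; simp
      nlinarith
  by_cases hzy : z = y
  · subst hzy
    rw [dist_comm z p, hz1, hz2, dist_self]
    nlinarith
  have hpz := dist_pos.2 hzp
  have hxz := dist_pos.2 hzx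
  have hyz := dist_pos.2 hzy
  have hd : 0 < dist p x := by
    rcases (dist_nonneg (x := p) (y := x)).lt_or_eq with h | h
    · exact h
    · rw [← h] at hz2; simp at hz2; exact absurd hz2 hzx
  have hc := hcurv z p x y (Ne.symm hzp) (Ne.symm hzx) (Ne.symm hzy)
  have hl : 0 < l := by
    rw [dist_comm, hz1] at hpz; exact pos_of_mul_pos_left hpz hd.le
  have hl1 : 0 < 1 - l := by
    rw [hz2] at hxz; exact pos_of_mul_pos_left hxz hd.le
  have e1 : compAngle₀ p z x = Real.pi := by
    unfold compAngle₀
    rw [dist_comm z p, hz1, hz2]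
    rw [show ((l * dist p x) ^ 2 + ((1 - l) * dist p x) ^ 2 - dist p x ^ 2) /
      (2 * (l * dist p x) * ((1 - l) * dist p x)) = -1 by field_simp; ring]
    exact Real.arccos_neg_one
  rw [e1] at hc
  have hc2 : compAngle₀ x z y ≤ Real.pi - compAngle₀ y z p := by linarith
  obtain ⟨b1, b2⟩ := comp_arg_bounds x z y (Ne.symm hzx) (Ne.symm hzy)
  obtain ⟨b3, b4⟩ := comp_arg_bounds y z p (Ne.symm hzy) (Ne.symm hzp)
  have hcos := Real.cos_le_cos_of_nonneg_of_le_pi (x := compAngle₀ x z y)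
    (y := Real.pi - compAngle₀ y z p) (Real.arccos_nonneg _)
    (by have : 0 ≤ compAngle₀ y z p := Real.arccos_nonneg _
        linarith) hc2
  rw [Real.cos_pi_sub] at hcos
  unfold compAngle₀ at hcos
  rw [Real.cos_arccos b3 b4, Real.cos_arccos b1 b2, dist_comm z p, hz1, hz2] at hcos
  rw [dist_comm y z, ← sub_nonneg]
  have hh : 0 ≤ (((1 - l) * dist p x) ^ 2 + dist z y ^ 2 - dist x y ^ 2) /
      (2 * ((1 - l) * dist p x) * dist z y) + (dist z y ^ 2 + (l * dist p x) ^ 2 - dist y p ^ 2) /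
      (2 * dist z y * (l * dist p x)) := by linarith
  have hh2 := mul_nonneg hh (show 0 ≤ 2 * dist z y * l * (1 - l) * dist p x by positivity)
  rw [dist_comm y x]
  calc 0 ≤ _ := hh2
    _ = _ := by field_simp; ring

/-- Contraction towards a point does not shrink distances by more than the ratio. -/
theorem contract_ineq {X : Type*} [MetricSpace X] (hcurv : CurvCompGE0 X)
    (p x y xa ya : X) (l : ℝ) (h0 : 0 ≤ l) (h1 : l ≤ 1)
    (hx1 : dist p xa = l * dist p x) (hx2 : dist xa x = (1 - l) * dist p x)
    (hy1 : dist p ya = l * dist p y) (hy2 : dist ya y = (1 - l) * dist p y) :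
    l * dist x y ≤ dist xa ya := by
  have a1 := concave_ineq hcurv p x ya xa l h0 h1 hx1 hx2
  have a2 := concave_ineq hcurv p y x ya l h0 h1 hy1 hy2
  rw [dist_comm ya p, hy1, dist_comm ya x, dist_comm ya xa] at a1
  rw [dist_comm x p] at a2
  rw [← pow_le_pow_iff_left₀ (mul_nonneg h0 dist_nonneg) dist_nonneg two_ne_zero]
  nlinarith [mul_le_mul_of_nonneg_left a2 h0]

/-- Contraction maps. -/
theorem exists_contract {X : Type*} [MetricSpace X] [CompactSpace X] (hgeo : GeodesicSpace X)
    (hcurv : CurvCompGE0 X) (p : X) (l : ℝ) (h0 : 0 ≤ l) (h1 : l ≤ 1) :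
    ∃ f : X → X, (∀ x, dist p (f x) = l * dist p x) ∧ (∀ x, dist (f x) x = (1 - l) * dist p x) ∧
      (∀ x y, l * dist x y ≤ dist (f x) (f y)) := by
  choose f hf1 hf2 using fun x => ratio_point hgeo p x l h0 h1
  exact ⟨f, hf1, hf2, fun x y =>
    contract_ineq hcurv p x y _ _ l h0 h1 (hf1 x) (hf2 x) (hf1 y) (hf2 y)⟩

/-- A space of dimension less than `s` has finite covers with small sum of powers of diameters. -/
theorem exists_small_cover {X : Type*} [MetricSpace X] [CompactSpace X] (s : NNReal) (hs : 0 < s)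
    (hdim : dimH (Set.univ : Set X) < s) (η : ℝ) (hη : 0 < η) :
    ∃ (S : Finset ℕ) (U : ℕ → Set X), (Set.univ : Set X) ⊆ ⋃ i ∈ S, U i ∧
      ∑ i ∈ S, diam (U i) ^ (s : ℝ) < η := by
  borelize X
  have h0 : MeasureTheory.Measure.hausdorffMeasure (s : ℝ) (Set.univ : Set X) = 0 :=
    hausdorffMeasure_of_dimH_lt hdim
  rw [MeasureTheory.Measure.hausdorffMeasure_apply] at h0
  have h1 : (⨅ (t : ℕ → Set X) (_ : Set.univ ⊆ ⋃ n, t n) (_ : ∀ n, ediam (t n) ≤ 1),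
          ∑' n, ⨆ _ : (t n).Nonempty, ediam (t n) ^ (s : ℝ)) < ENNReal.ofReal (η / 2) := by
    refine lt_of_le_of_lt ?_ (ENNReal.ofReal_pos.2 (half_pos hη))
    rw [← h0]
    exact le_iSup₂ (f := fun (r : ENNReal) (_ : 0 < r) =>
      ⨅ (t : ℕ → Set X) (_ : Set.univ ⊆ ⋃ n, t n) (_ : ∀ n, ediam (t n) ≤ r),
          ∑' n, ⨆ _ : (t n).Nonempty, ediam (t n) ^ (s : ℝ)) 1 one_pos
  simp only [iInf_lt_iff] at h1
  obtain ⟨t, hcov, -, hsum⟩ := h1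
  have hbdd : ∀ A : Set X, Bornology.IsBounded A := fun A =>
    isCompact_univ.isBounded.subset (Set.subset_univ A)
  have hδ : ∀ n : ℕ, ∃ δ > 0, (diam (t n) + 2 * δ) ^ (s : ℝ) <
      diam (t n) ^ (s : ℝ) + η / 2 / 2 / 2 ^ n := by
    intro n
    have hc : Continuous (fun δ : ℝ => (diam (t n) + 2 * δ) ^ (s : ℝ)) := by
      refine Continuous.rpow_const (by fun_prop) (fun x => Or.inr s.2)
    have := hc.tendsto 0
    have h3 := this.eventually_lt_const (u := diam (t n) ^ (s : ℝ) + η / 2 / 2 / 2 ^ n) (by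
      simp; positivity)
    obtain ⟨δ, h4, h5⟩ := ((h3.filter_mono (nhdsWithin_le_nhds (s := Set.Ioi 0))).and
      self_mem_nhdsWithin).exists
    exact ⟨δ, h5, h4⟩
  choose δ hδ0 hδ using hδ
  obtain ⟨S, hS⟩ := isCompact_univ.elim_finite_subcover (fun n => thickening (δ n) (t n))
    (fun n => isOpen_thickening) (hcov.trans (Set.iUnion_mono fun n =>
      self_subset_thickening (hδ0 n) _))
  refine ⟨S, fun n => thickening (δ n) (t n), hS, ?_⟩
  have hb1 : ∑ i ∈ S, diam (t i) ^ (s : ℝ) < η / 2 := by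
    have e : ENNReal.ofReal (∑ i ∈ S, diam (t i) ^ (s : ℝ)) < ENNReal.ofReal (η / 2) := by
      refine lt_of_le_of_lt ?_ hsum
      refine le_trans ?_ (ENNReal.sum_le_tsum S)
      rw [ENNReal.ofReal_sum_of_nonneg (fun i _ => Real.rpow_nonneg diam_nonneg _)]
      refine Finset.sum_le_sum fun i _ => ?_
      rcases (t i).eq_empty_or_nonempty with h | h
      · rw [h]
        simp [Real.zero_rpow (NNReal.coe_ne_zero.2 hs.ne')]
      · simp only [h, iSup_pos]
        rw [← ENNReal.ofReal_rpow_of_nonneg diam_nonneg s.coe_nonneg]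
        gcongr
        unfold diam
        exact ENNReal.ofReal_toReal_le
    exact (ENNReal.ofReal_lt_ofReal_iff (half_pos hη)).1 e
  have hb2 : ∑ i ∈ S, η / 2 / 2 / 2 ^ i ≤ η / 2 := by
    refine (Summable.sum_le_tsum S (fun i _ => by positivity) (summable_geometric_two' _)).trans ?_
    rw [tsum_geometric_two']
  calc ∑ i ∈ S, diam (thickening (δ i) (t i)) ^ (s : ℝ)
      ≤ ∑ i ∈ S, (diam (t i) ^ (s : ℝ) + η / 2 / 2 / 2 ^ i) := by
        refine Finset.sum_le_sum fun i _ => ?_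
        refine le_trans ?_ (hδ i).le
        exact Real.rpow_le_rpow diam_nonneg (diam_thickening_le _ (hδ0 i).le) s.2
    _ < η := by rw [Finset.sum_add_distrib]; linarith

/-- Finite covers of a self-similar piece cannot have small sum of powers of diameters. -/
theorem cover_lower {X : Type*} [MetricSpace X] [CompactSpace X] (s : ℝ) (hs : 0 < s)
    (A : Set X) (hA : A.Nonempty) (T : Finset X) (f : X → X → X) (l g : ℝ) (hl : 0 < l)
    (hg : 0 < g)
    (hexp : ∀ i ∈ T, ∀ x y, l * dist x y ≤ dist (f i x) (f i y))
    (hfA : ∀ i ∈ T, ∀ x ∈ A, f i x ∈ A)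
    (hsep : ∀ i ∈ T, ∀ j ∈ T, i ≠ j → ∀ x ∈ A, ∀ y ∈ A, g ≤ dist (f i x) (f j y))
    (hcard : 1 < T.card) (hbig : 1 ≤ T.card * l ^ s) (n : ℕ) :
    ∀ (S : Finset ℕ) (U : ℕ → Set X), S.card = n → A ⊆ ⋃ i ∈ S, U i →
      g ^ s ≤ ∑ i ∈ S, diam (U i) ^ s := by
  classical
  have hbdd : ∀ A : Set X, Bornology.IsBounded A := fun A =>
    isCompact_univ.isBounded.subset (Set.subset_univ A)
  induction n using Nat.strong_induction_on with
  | _ n ih =>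
  intro S U hSn hcov
  by_contra! hlt
  have hnn : ∀ i, 0 ≤ diam (U i) ^ s := fun i => Real.rpow_nonneg diam_nonneg _
  have hdiam : ∀ j ∈ S, diam (U j) < g := by
    intro j hj
    by_contra! h
    have h1 : g ^ s ≤ diam (U j) ^ s := Real.rpow_le_rpow hg.le h hs.le
    have h2 := Finset.single_le_sum (fun i _ => hnn i) hj
    linarith
  let P : X → Finset ℕ := fun i => S.filter fun j => (U j ∩ Set.image (f i) A).Nonempty
  have hPsub : ∀ i, P i ⊆ S := fun i => Finset.filter_subset _ _
  have hPdisj : ∀ i ∈ T, ∀ j ∈ T, i ≠ j → Disjoint (P i) (P j) := by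
    intro i hi j hj hij
    rw [Finset.disjoint_left]
    intro k hk1 hk2
    obtain ⟨hkS, ⟨_, hu, x, hx, rfl⟩⟩ := Finset.mem_filter.1 hk1
    obtain ⟨-, ⟨_, hv, y, hy, rfl⟩⟩ := Finset.mem_filter.1 hk2
    have h1 := dist_le_diam_of_mem (hbdd _) hu hv
    have h2 := hsep i hi j hj hij x hx y hy
    linarith [hdiam k hkS]
  have hPcov : ∀ i ∈ T, A ⊆ ⋃ k ∈ P i, Set.preimage (f i) (U k) := by
    intro i hi x hx
    have := hcov (hfA i hi x hx)
    simp only [Set.mem_iUnion, exists_prop] at this ⊢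
    obtain ⟨k, hk, hu⟩ := this
    exact ⟨k, Finset.mem_filter.2 ⟨hk, ⟨_, hu, x, hx, rfl⟩⟩, hu⟩
  have hPne : ∀ i ∈ T, (P i).Nonempty := by
    intro i hi
    obtain ⟨x, hx⟩ := hA
    have := hPcov i hi hx
    simp only [Set.mem_iUnion, exists_prop] at this
    obtain ⟨k, hk, -⟩ := this
    exact ⟨k, hk⟩
  have hPcard : ∀ i ∈ T, (P i).card < n := by
    intro i hi
    obtain ⟨j, hj, hji⟩ := Finset.exists_mem_ne hcard i
    obtain ⟨k, hk⟩ := hPne j hj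
    rw [← hSn]
    refine Finset.card_lt_card ⟨hPsub i, fun h => ?_⟩
    exact Finset.disjoint_left.1 (hPdisj j hj i hi hji) hk (h (hPsub j hk))
  have hstep : ∀ i ∈ T, l ^ s * g ^ s ≤ ∑ k ∈ P i, diam (U k) ^ s := by
    intro i hi
    have h1 := ih _ (hPcard i hi) (P i) (fun k => Set.preimage (f i) (U k)) rfl (hPcov i hi)
    refine le_trans (mul_le_mul_of_nonneg_left h1 (Real.rpow_nonneg hl.le _)) ?_
    rw [Finset.mul_sum]
    refine Finset.sum_le_sum fun k _ => ?_
    rw [← Real.mul_rpow hl.le diam_nonneg]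
    refine Real.rpow_le_rpow (mul_nonneg hl.le diam_nonneg) ?_ hs.le
    rw [mul_comm, ← le_div_iff₀ hl]
    refine diam_le_of_forall_dist_le (div_nonneg diam_nonneg hl.le) fun x hx y hy => ?_
    rw [le_div_iff₀ hl, mul_comm]
    exact (hexp i hi x y).trans (dist_le_diam_of_mem (hbdd _) hx hy)
  have h1 : ∑ i ∈ T, ∑ k ∈ P i, diam (U k) ^ s ≤ ∑ k ∈ S, diam (U k) ^ s := by
    rw [← Finset.sum_biUnion (fun i hi j hj hij => hPdisj i hi j hj hij)]
    exact Finset.sum_le_sum_of_subset_of_nonneg (Finset.biUnion_subset.2 fun i _ => hPsub i)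
      (fun i _ _ => hnn i)
  have h2 := Finset.sum_le_sum hstep
  rw [Finset.sum_const, nsmul_eq_mul] at h2
  have h3 : 0 < g ^ s := Real.rpow_pos_of_pos hg s
  nlinarith

/-- Uniform packing bound in balls. -/
theorem packing_bound {X : Type*} [MetricSpace X] [CompactSpace X] (hgeo : GeodesicSpace X)
    (hcurv : CurvCompGE0 X) (s : NNReal) (hs : 0 < s)
    (hdim : dimH (Set.univ : Set X) < s) (q : X) (R τ : ℝ) (hR : 0 < R) (hτ : 0 < τ)
    (hτ1 : τ ≤ 1) (T : Finset X) (hTb : ∀ x ∈ T, dist q x ≤ R)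
    (hTs : ∀ x ∈ T, ∀ y ∈ T, x ≠ y → R * τ ≤ dist x y) :
    (T.card : ℝ) ≤ (12 / τ) ^ (s : ℝ) := by
  by_contra! hlt
  have hspos : (0 : ℝ) < s := hs
  have hl : 0 < τ / 12 := by positivity
  have h12 : (12 / τ) = (τ / 12)⁻¹ := by rw [inv_div]
  have hbig : 1 ≤ T.card * (τ / 12) ^ (s : ℝ) := by
    rw [h12, Real.inv_rpow hl.le] at hlt
    have := Real.rpow_pos_of_pos hl s
    rw [inv_lt_iff_one_lt_mul₀ this] at hlt
    linarith
  have hcard : 1 < T.card := by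
    have : (1 : ℝ) ≤ (12 / τ) ^ (s : ℝ) := by
      apply Real.one_le_rpow _ hspos.le
      rw [le_div_iff₀ hτ]; linarith
    exact_mod_cast this.trans_lt hlt
  choose f hf1 hf2 hf3 using fun p => exists_contract hgeo hcurv p (τ / 12) hl.le (by linarith)
  have hnear : ∀ i ∈ T, ∀ x ∈ closedBall q (2 * R), dist i (f i x) ≤ R * τ / 4 := by
    intro i hi x hx
    rw [hf1]
    have h1 := hTb i hi
    rw [mem_closedBall] at hx
    have h2 := dist_triangle i q x
    rw [dist_comm i q, dist_comm q x] at h2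
    nlinarith
  obtain ⟨S, U, hcov, hsum⟩ := exists_small_cover s hs hdim ((R * τ / 2) ^ (s : ℝ))
    (Real.rpow_pos_of_pos (by positivity) _)
  refine absurd hsum (not_lt.2 ?_)
  refine cover_lower s hspos (closedBall q (2 * R)) ⟨q, mem_closedBall_self (by positivity)⟩ T f
    (τ / 12) (R * τ / 2) hl (by positivity) (fun i _ => hf3 i) ?_ ?_ hcard hbig _ S U rfl
    ((Set.subset_univ _).trans hcov)
  · intro i hi x hx
    have h1 := hnear i hi x hx
    rw [mem_closedBall]
    have h2 := dist_triangle q i (f i x)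
    rw [dist_comm _ q]
    nlinarith [hTb i hi]
  · intro i hi j hj hij x hx y hy
    have h1 := hnear i hi x hx
    have h2 := hnear j hj y hy
    have h3 := hTs i hi j hj hij
    have h4 := dist_triangle4 i (f i x) (f j y) j
    rw [dist_comm (f j y) j] at h4
    linarith

/-- Local slow growth of a distance function implies a global bound. -/
theorem global_growth {X : Type*} [MetricSpace X] [CompactSpace X] (hgeo : GeodesicSpace X)
    (hcurv : CurvCompGE0 X) (p q : X) (ε δ : ℝ) (hε : 0 < ε) (hε1 : ε ≤ 1) (hδ : 0 < δ)
    (h : ∀ x : X, 0 < dist q x → dist q x < δ → dist p x ≤ dist p q + ε * dist q x) (y : X) :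
    dist p y ^ 2 ≤ dist p q ^ 2 + dist q y ^ 2 + 2 * dist p q * ε * dist q y := by
  by_cases hqy : q = y
  · subst hqy; simp
  have hd : 0 < dist q y := dist_pos.2 hqy
  obtain ⟨t, ht0, ht1, htδ⟩ : ∃ t : ℝ, 0 < t ∧ t ≤ 1 ∧ t * dist q y < δ := by
    refine ⟨min 1 (δ / 2 / dist q y), by positivity, min_le_left _ _, ?_⟩
    calc _ ≤ (δ / 2 / dist q y) * dist q y := by gcongr; exact min_le_right _ _
      _ = δ / 2 := by field_simp
      _ < δ := by linarith
  obtain ⟨z, hz1, hz2⟩ := ratio_point hgeo q y t ht0.le ht1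
  have h1 := h z (by rw [hz1]; positivity) (by rw [hz1]; exact htδ)
  have h2 := concave_ineq hcurv q y p z t ht0.le ht1 hz1 hz2
  rw [hz1] at h1
  have h3 : dist p z ^ 2 ≤ (dist p q + ε * (t * dist q y)) ^ 2 :=
    pow_le_pow_left₀ dist_nonneg h1 2
  have h4 : ε ^ 2 * (t ^ 2 * dist q y ^ 2) ≤ t ^ 2 * dist q y ^ 2 := by
    have : ε ^ 2 ≤ 1 := by nlinarith
    have : 0 ≤ t ^ 2 * dist q y ^ 2 := by positivity
    nlinarith
  have h5 : t * dist p y ^ 2 ≤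
      t * (dist p q ^ 2 + dist q y ^ 2 + 2 * dist p q * ε * dist q y) := by nlinarith
  exact le_of_mul_le_mul_left h5 ht0

set_option maxHeartbeats 1000000 in
/-- If the conclusion fails for `p, q`, then separated sets in `X` are small. -/
theorem sep_bound {X : Type*} [MetricSpace X] [CompactSpace X] (hgeo : GeodesicSpace X)
    (hcurv : CurvCompGE0 X) (s : NNReal) (hs : 0 < s)
    (hdim : dimH (Set.univ : Set X) < s) (D : ℝ) (hD : 0 < D) (hDX : ∀ x y : X, dist x y ≤ D)
    (ε : ℝ) (hε : 0 < ε) (hε1 : 20 * ε ≤ 1) (hεD : 2 * ε ≤ D) (p q : X) (hpq : p ≠ q)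
    (ha : dist p q < ε ^ 2)
    (H1 : ∀ y, dist p y ^ 2 ≤ dist p q ^ 2 + dist q y ^ 2 + 2 * dist p q * ε * dist q y)
    (H2 : ∀ y, dist q y ^ 2 ≤ dist p q ^ 2 + dist p y ^ 2 + 2 * dist p q * ε * dist p y)
    (T : Finset X) (hT : ∀ x ∈ T, ∀ y ∈ T, x ≠ y → D * ε ≤ dist x y) :
    (T.card : ℝ) ≤ 40 * ε * (48 / ε) ^ (s : ℝ) := by
  classical
  obtain ⟨a, rfl⟩ : ∃ a, a = dist p q := ⟨_, rfl⟩
  set a := dist p q with hadef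
  have ha0 : 0 < a := dist_pos.2 hpq
  have haε : a ≤ ε := by nlinarith
  have hlD : ε * a / D * D = ε * a := by field_simp
  have hl0 : 0 < ε * a / D := by positivity
  have hl1 : ε * a / D ≤ 1 := by
    rw [div_le_one hD]; nlinarith
  set l := ε * a / D with hl
  obtain ⟨f, hf1, hf2, hf3⟩ := exists_contract hgeo hcurv q l hl0.le hl1
  have hfq : ∀ x, dist q (f x) ≤ ε * a := by
    intro x
    rw [hf1, ← hlD]
    exact mul_le_mul_of_nonneg_left (hDX _ _) hl0.le
  have hup : ∀ x, dist p (f x) ≤ a * (1 + 3 * ε ^ 2) := by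
    intro x
    have h1 := H1 (f x)
    have h2 := hfq x
    have h0 : 0 ≤ dist q (f x) := dist_nonneg
    rw [← pow_le_pow_iff_left₀ dist_nonneg (by positivity) two_ne_zero]
    have h3 : dist q (f x) ^ 2 ≤ (ε * a) ^ 2 := pow_le_pow_left₀ h0 h2 2
    have h4 : 2 * a * ε * dist q (f x) ≤ 2 * a * ε * (ε * a) :=
      mul_le_mul_of_nonneg_left h2 (by positivity)
    nlinarith [show 0 ≤ (a * (3 * ε ^ 2)) ^ 2 by positivity, show 0 ≤ a ^ 2 * ε ^ 2 by positivity]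
  have hlow : ∀ x, a * (1 - 3 * ε ^ 2) ≤ dist p (f x) := by
    intro x
    have h1 := concave_ineq hcurv q x p (f x) l hl0.le hl1 (hf1 x) (hf2 x)
    rw [← hadef] at h1
    have h2 := mul_le_mul_of_nonneg_left (H2 x) hl0.le
    have h3 : l * (2 * a * ε * dist p x) ≤ 2 * a * ε * (ε * a) := by
      have := mul_le_mul_of_nonneg_left (hDX p x) hl0.le
      rw [hlD] at this
      nlinarith [mul_le_mul_of_nonneg_left this (show 0 ≤ 2 * a * ε by positivity)]
    have h4 : 2 * l * a ^ 2 ≤ ε ^ 2 * a ^ 2 := by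
      have : 2 * l ≤ ε ^ 2 := by
        rw [hl, ← mul_div_assoc, div_le_iff₀ hD]
        nlinarith
      nlinarith [sq_nonneg a]
    have h5 : a ^ 2 * (1 - 3 * ε ^ 2) ≤ dist p (f x) ^ 2 := by
      nlinarith [sq_nonneg (l * dist q x)]
    have h6 : 0 ≤ 1 - 3 * ε ^ 2 := by nlinarith
    rw [← pow_le_pow_iff_left₀ (by positivity) dist_nonneg two_ne_zero]
    refine le_trans ?_ h5
    rw [mul_pow]
    have : (1 - 3 * ε ^ 2) ^ 2 ≤ 1 - 3 * ε ^ 2 := by nlinarith [sq_nonneg ε]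
    nlinarith [sq_nonneg a]
  set K := ⌊1 / (20 * ε)⌋₊ with hK
  have hK1 : (K : ℝ) * (20 * ε) ≤ 1 := by
    rw [← le_div_iff₀ (by positivity)]
    exact Nat.floor_le (by positivity)
  have hK2 : 1 ≤ (K : ℝ) * (40 * ε) := by
    have h1 : 1 ≤ K := by
      rw [hK, Nat.one_le_floor_iff, le_div_iff₀ (by positivity)]; linarith
    have hone : (1 : ℝ) ≤ K := by exact_mod_cast h1
    have h2 := Nat.lt_floor_add_one (1 / (20 * ε))
    rw [← hK, div_lt_iff₀ (by positivity)] at h2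
    nlinarith
  have hkε : ∀ k : ℕ, k < K → 10 * (k : ℝ) * ε ^ 2 ≤ ε / 2 := by
    intro k hk
    have : (k : ℝ) ≤ K := by exact_mod_cast hk.le
    have h2 : (k : ℝ) * (20 * ε) ≤ 1 := by nlinarith
    nlinarith
  have hg : ∀ k : ℕ, ∃ g : X → X, k < K →
      (∀ x, dist p (g x) = (1 - 10 * k * ε ^ 2) * dist p x) ∧
      (∀ x, dist (g x) x = (10 * k * ε ^ 2) * dist p x) ∧
      (∀ x y, (1 - 10 * k * ε ^ 2) * dist x y ≤ dist (g x) (g y)) := by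
    intro k
    by_cases hk : k < K
    · have h1 := hkε k hk
      obtain ⟨g, g1, g2, g3⟩ := exists_contract hgeo hcurv p (1 - 10 * k * ε ^ 2)
        (by linarith) (by have : 0 ≤ 10 * (k : ℝ) * ε ^ 2 := by positivity
                          linarith)
      exact ⟨g, fun _ => ⟨g1, fun x => by rw [g2]; ring, g3⟩⟩
    · exact ⟨id, fun h => absurd h hk⟩
  choose g hg using hg
  have hgap : ∀ k m : ℕ, k < K → m < K → k < m → ∀ x y,
      2 * ε * a * (ε / 4) ≤ dist (g k (f x)) (g m (f y)) := by
    intro k m hk hm hkm x y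
    have h1 := (hg k hk).1 (f x)
    have h2 := (hg m hm).1 (f y)
    have h3 := dist_triangle p (g m (f y)) (g k (f x))
    rw [dist_comm (g m (f y))] at h3
    have h4 : (k : ℝ) + 1 ≤ m := by exact_mod_cast hkm
    have h5 := hkε k hk
    have h6 := hkε m hm
    have h7 : (1 - 10 * k * ε ^ 2) * (a * (1 - 3 * ε ^ 2)) ≤ dist p (g k (f x)) := by
      rw [h1]; exact mul_le_mul_of_nonneg_left (hlow x) (by linarith)
    have h8 : dist p (g m (f y)) ≤ (1 - 10 * m * ε ^ 2) * (a * (1 + 3 * ε ^ 2)) := by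
      rw [h2]; exact mul_le_mul_of_nonneg_left (hup y) (by linarith)
    have hk0 : 0 ≤ 10 * (k : ℝ) * ε ^ 2 := by positivity
    have hm0 : 0 ≤ 10 * (m : ℝ) * ε ^ 2 := by positivity
    have hea : 0 ≤ a * ε ^ 2 := by positivity
    have h9 : (1 - 10 * k * ε ^ 2) * (a * (1 - 3 * ε ^ 2)) ≥
        a - 10 * k * ε ^ 2 * a - 3 * (a * ε ^ 2) := by
      nlinarith [mul_nonneg hk0 hea]
    have h10 : (1 - 10 * m * ε ^ 2) * (a * (1 + 3 * ε ^ 2)) ≤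
        a - 10 * m * ε ^ 2 * a + 3 * (a * ε ^ 2) := by
      nlinarith [mul_nonneg hm0 hea]
    nlinarith
  have hsep : ∀ u ∈ Finset.range K ×ˢ T, ∀ v ∈ Finset.range K ×ˢ T, u ≠ v →
      2 * ε * a * (ε / 4) ≤ dist (g u.1 (f u.2)) (g v.1 (f v.2)) := by
    rintro ⟨k, x⟩ hu ⟨m, y⟩ hv huv
    simp only [Finset.mem_product, Finset.mem_range] at hu hv
    rcases lt_trichotomy k m with h | h | h
    · exact hgap k m hu.1 hv.1 h x y
    · subst h
      have hxy : x ≠ y := fun h => huv (by rw [h])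
      have h1 := hT x hu.2 y hv.2 hxy
      have h2 := (hg k hu.1).2.2 (f x) (f y)
      have h3 := hf3 x y
      have h4 := hkε k hu.1
      have h5 : l * (D * ε) ≤ dist (f x) (f y) :=
        (mul_le_mul_of_nonneg_left h1 hl0.le).trans h3
      have h6 : l * (D * ε) = ε * a * ε := by rw [← mul_assoc, hlD]
      rw [h6] at h5
      have h7 : (1 / 2) * (ε * a * ε) ≤ (1 - 10 * k * ε ^ 2) * dist (f x) (f y) :=
        mul_le_mul (by linarith) h5 (by positivity) (by linarith)
      simp only
      linarith
    · rw [dist_comm]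
      exact hgap m k hv.1 hu.1 h y x
  have hinj : Set.InjOn (fun u : ℕ × X => g u.1 (f u.2)) (Finset.range K ×ˢ T : Finset (ℕ × X)) := by
    intro u hu v hv huv
    by_contra hne
    have := hsep u hu v hv hne
    simp only at huv
    rw [huv, dist_self] at this
    have : 0 < 2 * ε * a * (ε / 4) := by positivity
    linarith
  have hpack := packing_bound hgeo hcurv s hs hdim q (2 * ε * a) (ε / 4) (by positivity)
    (by positivity) (by linarith) ((Finset.range K ×ˢ T).image fun u : ℕ × X => g u.1 (f u.2))
    (by
      intro z hz
      obtain ⟨⟨k, x⟩, hu, rfl⟩ := Finset.mem_image.1 hz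
      simp only [Finset.mem_product, Finset.mem_range] at hu
      have h1 := (hg k hu.1).2.1 (f x)
      have h2 := hfq x
      have h3 := hup x
      have h4 := hkε k hu.1
      have h5 := dist_triangle q (f x) (g k (f x))
      rw [dist_comm (f x), h1] at h5
      have h6 : dist p (f x) ≤ 2 * a := by
        have : 3 * ε ^ 2 ≤ 1 := by nlinarith
        nlinarith
      have h7 : 10 * k * ε ^ 2 * dist p (f x) ≤ ε / 2 * (2 * a) :=
        mul_le_mul h4 h6 dist_nonneg (by positivity)
      simp only
      linarith)
    (by
      intro z hz w hw hzw
      obtain ⟨u, hu, rfl⟩ := Finset.mem_image.1 hz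
      obtain ⟨v, hv, rfl⟩ := Finset.mem_image.1 hw
      exact hsep u hu v hv (fun h => hzw (by rw [h])))
  rw [Finset.card_image_of_injOn hinj, Finset.card_product, Finset.card_range,
    show 12 / (ε / 4) = 48 / ε by field_simp; norm_num] at hpack
  push_cast at hpack
  have hT0 : (0 : ℝ) ≤ T.card := Nat.cast_nonneg _
  calc (T.card : ℝ) ≤ (K * (40 * ε)) * T.card := by nlinarith
    _ = 40 * ε * (K * T.card) := by ring
    _ ≤ _ := by gcongr

/-- Bounded separated sets give finite nets. -/
theorem exists_net {X : Type*} [MetricSpace X] (r B : ℝ)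
    (hB : ∀ T : Finset X, (∀ x ∈ T, ∀ y ∈ T, x ≠ y → r ≤ dist x y) → (T.card : ℝ) ≤ B) :
    ∃ T : Finset X, (T.card : ℝ) ≤ B ∧ ∀ x, ∃ t ∈ T, dist x t ≤ r ∨ x = t := by
  classical
  let P : ℕ → Prop := fun n => ∃ T : Finset X, T.card = n ∧
    (∀ x ∈ T, ∀ y ∈ T, x ≠ y → r ≤ dist x y)
  have hbd : ∀ n, P n → n ≤ ⌊B⌋₊ := by
    rintro n ⟨T, rfl, hT⟩
    exact Nat.le_floor (hB T hT)
  have hP0 : P 0 := ⟨∅, rfl, by simp⟩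
  obtain ⟨T, hTc, hT⟩ : P (Nat.findGreatest P ⌊B⌋₊) := Nat.findGreatest_spec (Nat.zero_le _) hP0
  refine ⟨T, hB T hT, fun x => ?_⟩
  by_contra! h
  have hx : x ∉ T := fun hx => (h x hx).2 rfl
  have : P (T.card + 1) := by
    refine ⟨insert x T, Finset.card_insert_of_notMem hx, ?_⟩
    intro u hu v hv huv
    rcases Finset.mem_insert.1 hu with rfl | hu1 <;> rcases Finset.mem_insert.1 hv with rfl | hv1
    · exact absurd rfl huv
    · exact (h v hv1).1.le
    · rw [dist_comm]; exact (h u hu1).1.le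
    · exact hT u hu1 v hv1 huv
  have h2 := Nat.le_findGreatest (hbd _ this) this
  omega

/-- The extended diameter of a closed ball of real radius. -/
theorem ediam_closedBall_le_real {X : Type*} [MetricSpace X] (x : X) (r : ℝ) :
    ediam (closedBall x r) ≤ ENNReal.ofReal (2 * r) := by
  refine ediam_le fun y hy z hz => ?_
  rw [edist_dist]
  apply ENNReal.ofReal_le_ofReal
  rw [mem_closedBall] at hy hz
  have := dist_triangle_right y z x
  linarith

/-- Metric rendering of Lemma 3.1 of Perelman–Petrunin: for close enough distinct points `p, q`,
the distance to `p` can be increased at definite rate near `q`, or vice versa. -/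
theorem exists_eps_farthest_direction {X : Type*} [MetricSpace X] [CompactSpace X]
    (hdim : dimH (Set.univ : Set X) < ⊤)
    (hgeo : GeodesicSpace X) (hcurv : CurvCompGE0 X) :
    ∃ ε > (0 : ℝ), ∀ p q : X, p ≠ q → dist p q < ε ^ 2 →
      (∀ δ > (0 : ℝ), ∃ x : X, 0 < dist q x ∧ dist q x < δ ∧
        dist p q + ε * dist q x < dist p x) ∨
      (∀ δ > (0 : ℝ), ∃ x : X, 0 < dist p x ∧ dist p x < δ ∧
        dist p q + ε * dist p x < dist q x) := by
  by_contra! H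
  have hNT : ∃ p q : X, p ≠ q := by
    obtain ⟨p, q, h, -⟩ := H 1 one_pos
    exact ⟨p, q, h⟩
  obtain ⟨p₀, q₀, hne⟩ := hNT
  obtain ⟨D, hD, hDX⟩ : ∃ D : ℝ, 0 < D ∧ ∀ x y : X, dist x y ≤ D := by
    have hb : ∀ x y : X, dist x y ≤ diam (Set.univ : Set X) := fun x y =>
      dist_le_diam_of_mem isCompact_univ.isBounded (Set.mem_univ x) (Set.mem_univ y)
    exact ⟨_, (dist_pos.2 hne).trans_le (hb p₀ q₀), hb⟩
  obtain ⟨n, hn⟩ : ∃ n : NNReal, (n : ENNReal) = dimH (Set.univ : Set X) :=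
    ⟨_, ENNReal.coe_toNNReal hdim.ne⟩
  set s : NNReal := n + 1 / 2 with hsdef
  have hs : 0 < s := by positivity
  have hdims : dimH (Set.univ : Set X) < s := by
    rw [← hn, ENNReal.coe_lt_coe, hsdef]
    exact lt_add_of_pos_right _ (by positivity)
  set C : ℝ := 40 * 48 ^ (s : ℝ) with hC
  have hC0 : 0 < C := by positivity
  have hbound : ∀ ε : ℝ, 0 < ε → 20 * ε ≤ 1 → 2 * ε ≤ D → ∀ T : Finset X,
      (∀ x ∈ T, ∀ y ∈ T, x ≠ y → D * ε ≤ dist x y) → (T.card : ℝ) ≤ C * ε ^ (1 - (s : ℝ)) := by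
    intro ε hε h1 h2 T hT
    obtain ⟨p, q, hpq, ha, ⟨δ₁, hδ₁, hh1⟩, ⟨δ₂, hδ₂, hh2⟩⟩ := H ε hε
    have G1 := global_growth hgeo hcurv p q ε δ₁ hε (by linarith) hδ₁ hh1
    have G2 := global_growth hgeo hcurv q p ε δ₂ hε (by linarith) hδ₂
      (by rw [dist_comm q p]; exact hh2)
    rw [dist_comm q p] at G2
    refine (sep_bound hgeo hcurv s hs hdims D hD hDX ε hε h1 h2 p q hpq ha G1 G2 T hT).trans
      (le_of_eq ?_)
    rw [Real.div_rpow (by norm_num) hε.le, Real.rpow_sub hε, Real.rpow_one, hC]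
    ring
  obtain ⟨ε₀, hε₀, hε₁, hε₂⟩ : ∃ ε₀ : ℝ, 0 < ε₀ ∧ 20 * ε₀ ≤ 1 ∧ 2 * ε₀ ≤ D := by
    refine ⟨min (1 / 20) (D / 2), by positivity, ?_, ?_⟩
    · linarith [min_le_left (1 / 20) (D / 2)]
    · linarith [min_le_right (1 / 20) (D / 2)]
  set e : ℕ → ℝ := fun j => ε₀ * (1 / ((j : ℝ) + 1)) with he
  have he0 : ∀ j, 0 < e j := fun j => by positivity
  have hele : ∀ j, e j ≤ ε₀ := by
    intro j
    have : 1 / ((j : ℝ) + 1) ≤ 1 := by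
      rw [div_le_one (by positivity)]
      linarith [(Nat.cast_nonneg j : (0 : ℝ) ≤ j)]
    simp only [he]
    nlinarith
  have helim : Filter.Tendsto e Filter.atTop (nhds 0) := by
    have := (tendsto_one_div_add_atTop_nhds_zero_nat (𝕜 := ℝ)).const_mul ε₀
    rw [mul_zero] at this
    exact this
  have hbe : ∀ j, ∀ T : Finset X,
      (∀ x ∈ T, ∀ y ∈ T, x ≠ y → D * e j ≤ dist x y) → (T.card : ℝ) ≤ C * e j ^ (1 - (s : ℝ)) :=
    fun j => hbound (e j) (he0 j) (by linarith [hele j]) (by linarith [hele j])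
  rcases lt_or_ge s 1 with hs1 | hs1
  · have hpos : 0 < 1 - (s : ℝ) := by
      have : (s : ℝ) < 1 := by exact_mod_cast hs1
      linarith
    have hlim : Filter.Tendsto (fun j => C * e j ^ (1 - (s : ℝ))) Filter.atTop (nhds 0) := by
      have := (helim.rpow_const (p := 1 - (s : ℝ)) (Or.inr hpos.le)).const_mul C
      rw [Real.zero_rpow hpos.ne', mul_zero] at this
      exact this
    have h1 : ∀ j, (1 : ℝ) ≤ C * e j ^ (1 - (s : ℝ)) := by
      intro j
      have := hbe j {p₀} (by
        intro x hx y hy hxy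
        rw [Finset.mem_singleton.1 hx, Finset.mem_singleton.1 hy] at hxy
        exact absurd rfl hxy)
      simpa using this
    have := ge_of_tendsto' hlim h1
    linarith
  · obtain ⟨σ, hσ⟩ : ∃ σ : NNReal, s = σ + 1 := ⟨s - 1, (tsub_add_cancel_of_le hs1).symm⟩
    have hσs : 1 - (s : ℝ) = -(σ : ℝ) := by rw [hσ]; push_cast; ring
    rw [hσs] at hbe
    choose T hTc hTn using fun j => exists_net (D * e j) _ (hbe j)
    borelize X
    have hmeas : MeasureTheory.Measure.hausdorffMeasure (σ : ℝ) (Set.univ : Set X) ≤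
        ENNReal.ofReal (C * (2 * D) ^ (σ : ℝ)) := by
      refine (MeasureTheory.Measure.hausdorffMeasure_le_liminf_sum (ι := fun j => T j) (σ : ℝ)
        (Set.univ : Set X) (l := Filter.atTop) (fun j => ENNReal.ofReal (2 * (D * e j))) ?_
        (fun j t => closedBall (t : X) (D * e j)) ?_ ?_).trans ?_
      · have := ((helim.const_mul D).const_mul 2)
        rw [mul_zero, mul_zero] at this
        have := ENNReal.tendsto_ofReal this
        rwa [ENNReal.ofReal_zero] at this
      · exact Filter.Eventually.of_forall fun j t => ediam_closedBall_le_real _ _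
      · refine Filter.Eventually.of_forall fun j x _ => ?_
        obtain ⟨t, ht, hxt⟩ := hTn j x
        refine Set.mem_iUnion.2 ⟨⟨t, ht⟩, ?_⟩
        rw [mem_closedBall]
        rcases hxt with h | h
        · exact h
        · rw [h, dist_self]
          exact (mul_pos hD (he0 j)).le
      · refine (Filter.liminf_le_liminf (v := fun _ => ENNReal.ofReal (C * (2 * D) ^ (σ : ℝ)))
          (Filter.Eventually.of_forall fun j => ?_)).trans (by simp)
        have h0 := he0 j
        calc ∑ t : T j, ediam (closedBall (t : X) (D * e j)) ^ (σ : ℝ)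
            ≤ ∑ t : T j, ENNReal.ofReal (2 * (D * e j)) ^ (σ : ℝ) := by
              gcongr with t
              exact ediam_closedBall_le_real _ _
          _ = ENNReal.ofReal ((T j).card * (2 * (D * e j)) ^ (σ : ℝ)) := by
              rw [ENNReal.ofReal_rpow_of_nonneg (by positivity) σ.coe_nonneg, Finset.sum_const,
                nsmul_eq_mul, ENNReal.ofReal_mul (Nat.cast_nonneg _), ENNReal.ofReal_natCast]
              simp
          _ ≤ ENNReal.ofReal (C * (2 * D) ^ (σ : ℝ)) := by
              apply ENNReal.ofReal_le_ofReal
              calc _ ≤ C * e j ^ (-(σ : ℝ)) * (2 * (D * e j)) ^ (σ : ℝ) := by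
                    gcongr
                    exact hTc j
                _ = _ := by
                    rw [← mul_assoc 2 D, Real.mul_rpow (by positivity) h0.le, Real.rpow_neg h0.le]
                    have := (Real.rpow_pos_of_pos h0 (σ : ℝ)).ne'
                    field_simp
    have hle := dimH_le_of_hausdorffMeasure_ne_top (ne_top_of_le_ne_top ENNReal.ofReal_ne_top hmeas)
    rw [← hn, ENNReal.coe_le_coe] at hle
    have h1 : (n : ℝ) ≤ σ := by exact_mod_cast hle
    have h2 : (n : ℝ) + 1 / 2 = σ + 1 := by
      have := congrArg NNReal.toReal (hsdef.symm.trans hσ)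
      push_cast at this
      exact this
    linarith
end

section
/- Let M be a metric space and let x, y, z ∈ M be points satisfying: d(x,z) ≤ π, d(x,z) > π/2, d(y,z) ≤ d(x,z), d(x,y) ≤ π/2, and cos(d(x,z)) ≥ cos(d(x,y))·cos(d(y,z)). Then x = y. -/
/-- Rigidity lemma used in the proof of Corollary C: under the stated distance and cosine
constraints, the farthest direction `x` must coincide with the direction `y`. -/
theorem farthest_direction_rigidity {M : Type*} [MetricSpace M] (x y z : M)
    (h₁ : dist x z ≤ Real.pi) (h₂ : Real.pi / 2 < dist x z)
    (h₃ : dist y z ≤ dist x z) (h₄ : dist x y ≤ Real.pi / 2)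
    (h₅ : Real.cos (dist x y) * Real.cos (dist y z) ≤ Real.cos (dist x z)) :
    x = y := by
  have hpi := Real.pi_pos
  have hd : 0 ≤ dist x y := dist_nonneg
  have ha : 0 ≤ Real.cos (dist x y) :=
    Real.cos_nonneg_of_mem_Icc ⟨by linarith, h₄⟩
  have hc : Real.cos (dist x z) < 0 :=
    Real.cos_neg_of_pi_div_two_lt_of_lt h₂ (by linarith)
  have hb : Real.cos (dist x z) ≤ Real.cos (dist y z) :=
    Real.cos_le_cos_of_nonneg_of_le_pi dist_nonneg h₁ h₃
  have h1 : 1 ≤ Real.cos (dist x y) := by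
    by_contra! h
    nlinarith [mul_le_mul_of_nonneg_left hb ha]
  have h2 : Real.cos (dist x y) = 1 := le_antisymm (Real.cos_le_one _) h1
  have h3 : dist x y = 0 :=
    (Real.cos_eq_one_iff_of_lt_of_lt (by linarith) (by linarith)).1 h2
  exact dist_eq_zero.1 h3
end

section
/- Let M be a metric space and let p, q, r, s ∈ M with q ≠ p, r ≠ p and s ≠ p. For y, z ≠ p define c(y,z) = (d(p,y)² + d(p,z)² − d(y,z)²)/(2·d(p,y)·d(p,z)) (the cosine of the Euclidean comparison angle at p between y and z). If d(r,s)² + d(q,s)² ≥ d(q,r)², then c(r,q) ≥ −d(p,s)²/(d(p,q)·d(p,r)) + (d(p,s)/d(p,q))·c(r,s) + (d(p,s)/d(p,r))·c(q,s). -/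
/-- Inequality (1.3) in the proof of Theorem A: algebraic consequence of the Euclidean law of
cosines for the comparison-angle cosines at the base point `p`. -/
theorem comparison_cosine_inequality {M : Type*} [MetricSpace M] (p q r s : M)
    (hq : q ≠ p) (hr : r ≠ p) (hs : s ≠ p)
    (h : dist q r ^ 2 ≤ dist r s ^ 2 + dist q s ^ 2) :
    -(dist p s ^ 2) / (dist p q * dist p r)
      + (dist p s / dist p q) *
        ((dist p r ^ 2 + dist p s ^ 2 - dist r s ^ 2) / (2 * dist p r * dist p s))
      + (dist p s / dist p r) *
        ((dist p q ^ 2 + dist p s ^ 2 - dist q s ^ 2) / (2 * dist p q * dist p s))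
      ≤ (dist p r ^ 2 + dist p q ^ 2 - dist r q ^ 2) / (2 * dist p r * dist p q) := by
  have hq' : 0 < dist p q := dist_pos.mpr hq.symm
  have hr' : 0 < dist p r := dist_pos.mpr hr.symm
  have hs' : 0 < dist p s := dist_pos.mpr hs.symm
  rw [dist_comm r q]
  have key : -(dist p s ^ 2) / (dist p q * dist p r)
      + (dist p s / dist p q) *
        ((dist p r ^ 2 + dist p s ^ 2 - dist r s ^ 2) / (2 * dist p r * dist p s))
      + (dist p s / dist p r) *
        ((dist p q ^ 2 + dist p s ^ 2 - dist q s ^ 2) / (2 * dist p q * dist p s))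
      = (dist p r ^ 2 + dist p q ^ 2 - (dist r s ^ 2 + dist q s ^ 2))
        / (2 * dist p r * dist p q) := by
    field_simp
    ring
  rw [key]
  gcongr
end
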